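/- arXiv:2406.00910 — 7 statements merged into one kernel-verified Lean document; each statement's English description precedes it below -/
import Mathlib

section
/- Let ℝ^d = V ⊕ W with dim V = m and dim W = d−m, let B₁ ⊂ V and B₂ ⊂ W be open balls centered at 0, let P be a nonempty set of parameters, and let g_ε : P × B₁ → B₂ (for ε > 0) and g : B₁ → B₂ be C¹ disks (C¹ in the ball variable) such that sup_{η∈P} sup_{v∈B₁} (|g_ε(η,v) − g(v)| + ‖D_v g_ε(η,v) − Dg(v)‖) → 0 as ε → 0. Let z₀ = v₀ + g(v₀) be a point of graph(g), and let M be an invertible d×d matrix with M·(ℝ^m × {0}_{d−m}) = T_{z₀}g. Then for every L > 0 there exist ε₀ > 0, δ₁ > 0, δ₂ > 0 and balls B(0,δ₁) ⊂ ℝ^m × {0}_{d−m}, B(0,δ₂) ⊂ {0}_m × ℝ^{d−m}, such that for every ε ∈ (0,ε₀] and every η ∈ P there exists a map h_{ε,η} : B(0,δ₁) → B(0,δ₂) which is Lipschitz with constant L and satisfies M·graph(h_{ε,η}) ⊆ graph(g_ε(η,·)) − z₀; moreover, for every ρ > 0 the constants ε₀ and δ₁ can be chosen so that additionally δ₂ ≤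 ρ. -/
open Metric Set

/-- If `a` is close to the isomorphism `A` and `b` is Lipschitz on a closed ball, then the image of
the ball under `v ↦ (a v, b v)` contains the graph of a Lipschitz map over a ball around `0`. -/
theorem exists_lipschitzOnWith_graph_of_approximates
    {E F G : Type*} [NormedAddCommGroup E] [NormedSpace ℝ E] [CompleteSpace E]
    [NormedAddCommGroup F] [NormedSpace ℝ F] [NormedAddCommGroup G]
    (A : E ≃L[ℝ] F) (a : E → F) (b : E → G) (v₀ : E) {N c s t δ : ℝ}
    (hN : 0 < N) (hc : 0 ≤ c) (hs : 0 ≤ s) (hNc : N * c ≤ 1 / 2)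
    (hA : ∀ y, ‖A.symm y‖ ≤ N * ‖y‖)
    (ha : ∀ v ∈ closedBall v₀ s, ∀ v' ∈ closedBall v₀ s,
      ‖a v - a v' - A (v - v')‖ ≤ c * ‖v - v'‖)
    (hb : ∀ v ∈ closedBall v₀ s, ∀ v' ∈ closedBall v₀ s, ‖b v - b v'‖ ≤ c * ‖v - v'‖)
    (hat : ‖a v₀‖ ≤ t) (hbt : ‖b v₀‖ ≤ t) (hδ : 2 * N * (δ + t) ≤ s) :
    ∃ h : F → G, LipschitzOnWith (Real.toNNReal (2 * N * c)) h (ball 0 δ) ∧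
      (∀ x ∈ ball (0 : F) δ, ‖h x‖ ≤ t + c * s) ∧
      ∀ x ∈ ball (0 : F) δ, ∃ v ∈ closedBall v₀ s, a v = x ∧ b v = h x := by
  have happ : ApproximatesLinearOn a (A : E →L[ℝ] F) (closedBall v₀ s) (Real.toNNReal c) := by
    intro v hv v' hv'
    rw [Real.coe_toNNReal c hc]
    exact ha v hv v' hv'
  let R : (A : E →L[ℝ] F).NonlinearRightInverse :=
    { toFun := A.symm
      nnnorm := Real.toNNReal N
      bound' := fun y => by rw [Real.coe_toNNReal N hN.le]; exact hA y
      right_inv' := fun y => A.apply_symm_apply y }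
  have hcN : c ≤ N⁻¹ / 2 := by
    rw [inv_eq_one_div, div_div, le_div_iff₀ (by positivity)]
    linarith
  have hsurj : ∀ x ∈ ball (0 : F) δ, ∃ v ∈ closedBall v₀ s, a v = x := by
    intro x hx
    have hx' : x ∈ closedBall (a v₀) (((R.nnnorm : ℝ)⁻¹ - Real.toNNReal c) * s) := by
      change x ∈ closedBall (a v₀) (((Real.toNNReal N : ℝ)⁻¹ - Real.toNNReal c) * s)
      rw [Real.coe_toNNReal N hN.le, Real.coe_toNNReal c hc, mem_closedBall, dist_eq_norm]
      have h₁ : δ + t ≤ N⁻¹ / 2 * s := by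
        rw [inv_eq_one_div, div_div, div_mul_eq_mul_div, le_div_iff₀ (by positivity)]
        linarith
      have h₂ : N⁻¹ / 2 * s ≤ (N⁻¹ - c) * s := mul_le_mul_of_nonneg_right (by linarith) hs
      have h₃ := norm_sub_le x (a v₀)
      rw [mem_ball_zero_iff] at hx
      linarith
    exact happ.surjOn_closedBall_of_nonlinearRightInverse R hs subset_rfl hx'
  have hanti : ∀ v ∈ closedBall v₀ s, ∀ v' ∈ closedBall v₀ s,
      ‖v - v'‖ ≤ 2 * N * ‖a v - a v'‖ := by
    intro v hv v' hv'
    have h₁ := hA (A (v - v'))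
    rw [A.symm_apply_apply] at h₁
    have h₂ := norm_sub_norm_le (A (v - v')) (a v - a v')
    rw [norm_sub_rev (A (v - v'))] at h₂
    have h₃ := h₂.trans (ha v hv v' hv')
    have h₄ : N * ‖A (v - v')‖ ≤ N * (‖a v - a v'‖ + c * ‖v - v'‖) :=
      mul_le_mul_of_nonneg_left (by linarith) hN.le
    have h₅ := mul_le_mul_of_nonneg_right hNc (norm_nonneg (v - v'))
    linarith
  choose! σ hσ haσ using hsurj
  refine ⟨fun x => b (σ x), ?_, fun x hx => ?_, fun x hx => ⟨σ x, hσ x hx, haσ x hx, rfl⟩⟩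
  · refine LipschitzOnWith.of_dist_le_mul fun x hx y hy => ?_
    rw [dist_eq_norm, dist_eq_norm, Real.coe_toNNReal _ (by positivity)]
    have h₁ := hanti _ (hσ x hx) _ (hσ y hy)
    rw [haσ x hx, haσ y hy] at h₁
    calc ‖b (σ x) - b (σ y)‖ ≤ c * ‖σ x - σ y‖ := hb _ (hσ x hx) _ (hσ y hy)
      _ ≤ c * (2 * N * ‖x - y‖) := mul_le_mul_of_nonneg_left h₁ hc
      _ = 2 * N * c * ‖x - y‖ := by ring
  · have h₁ := hb _ (hσ x hx) v₀ (mem_closedBall_self hs)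
    have h₂ : c * ‖σ x - v₀‖ ≤ c * s :=
      mul_le_mul_of_nonneg_left (mem_closedBall_iff_norm.1 (hσ x hx)) hc
    have h₃ := norm_sub_norm_le (b (σ x)) (b v₀)
    linarith

/-- A map that is `C¹`-close to `g` is approximated near `v₀` by the derivative of `g` at `v₀`. -/
theorem norm_sub_sub_fderiv_le_of_fderiv_sub_le
    {E F : Type*} [NormedAddCommGroup E] [NormedSpace ℝ E]
    [NormedAddCommGroup F] [NormedSpace ℝ F] {f g : E → F} {g' : E →L[ℝ] F} {S : Set E}
    (hS : Convex ℝ S) {c₁ c₂ : ℝ}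
    (hf : ∀ v ∈ S, DifferentiableAt ℝ f v)
    (hfg : ∀ v ∈ S, ‖fderiv ℝ f v - fderiv ℝ g v‖ ≤ c₁)
    (hg' : ∀ v ∈ S, ‖fderiv ℝ g v - g'‖ ≤ c₂) {v v' : E} (hv : v ∈ S) (hv' : v' ∈ S) :
    ‖f v - f v' - g' (v - v')‖ ≤ (c₁ + c₂) * ‖v - v'‖ := by
  refine hS.norm_image_sub_le_of_norm_hasFDerivWithin_le' (f' := fderiv ℝ f)
    (fun x hx => (hf x hx).hasFDerivAt.hasFDerivWithinAt) (fun x hx => ?_) hv' hv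
  have h₁ : fderiv ℝ f x - g' = (fderiv ℝ f x - fderiv ℝ g x) + (fderiv ℝ g x - g') := by abel
  rw [h₁]
  exact (norm_add_le _ _).trans (add_le_add (hfg x hx) (hg' x hx))

/-- Reading the tangent space `{v + D v}` in the coordinates given by `M` yields an isomorphism
from `V` onto the first coordinate block. -/
theorem exists_continuousLinearEquiv_of_image_eq_tangentSpace
    {X Y : Type*} [NormedAddCommGroup X] [NormedSpace ℝ X] [NormedAddCommGroup Y] [NormedSpace ℝ Y]
    [FiniteDimensional ℝ X] [FiniteDimensional ℝ Y]
    {V W : Submodule ℝ (X × Y)} (hVW : Disjoint V W) (D : V →L[ℝ] W) (M : (X × Y) ≃L[ℝ] (X × Y))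
    (hM : M '' {p | p.2 = 0} = {p : X × Y | ∃ v : V, p = ↑v + ↑(D v)}) :
    ∃ A : V ≃L[ℝ] X, ∀ v : V, M.symm (↑v + ↑(D v)) = (A v, 0) := by
  let T : V →ₗ[ℝ] X × Y :=
    (M.symm : (X × Y) →ₗ[ℝ] X × Y) ∘ₗ (V.subtype + W.subtype ∘ₗ (D : V →ₗ[ℝ] W))
  have hT : ∀ v : V, T v = M.symm (↑v + ↑(D v)) := fun v => rfl
  have hT₂ : ∀ v, (T v).2 = 0 := by
    intro v
    have hv : (v : X × Y) + D v ∈ M '' {p | p.2 = 0} := hM ▸ ⟨v, rfl⟩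
    obtain ⟨p, hp, hpv⟩ := hv
    rw [hT, ← hpv, M.symm_apply_apply]
    exact hp
  have hinj : Function.Injective (LinearMap.fst ℝ X Y ∘ₗ T) := by
    rw [injective_iff_map_eq_zero]
    intro v hv
    have h₀ : T v = 0 := Prod.ext hv (hT₂ v)
    rw [hT, map_eq_zero_iff _ M.symm.injective] at h₀
    have hvW : (v : X × Y) ∈ W := by
      rw [eq_neg_of_add_eq_zero_left h₀]
      exact W.neg_mem (D v).2
    exact Subtype.ext (Submodule.disjoint_def.1 hVW v v.2 hvW)
  have hsurj : Function.Surjective (LinearMap.fst ℝ X Y ∘ₗ T) := by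
    intro x
    have hx : M (x, 0) ∈ {p : X × Y | ∃ v : V, p = ↑v + ↑(D v)} := hM ▸ ⟨(x, 0), rfl, rfl⟩
    obtain ⟨v, hv⟩ := hx
    refine ⟨v, ?_⟩
    rw [LinearMap.comp_apply, hT, ← hv, M.symm_apply_apply]
    rfl
  exact ⟨(LinearEquiv.ofBijective _ ⟨hinj, hsurj⟩).toContinuousLinearEquiv,
    fun v => Prod.ext rfl (hT₂ v)⟩

/-- Lemma on reparameterization of disks over a tangent space.
`ℝ^d` is represented as `(Fin m → ℝ) × (Fin k → ℝ)` with `k = d - m`; block coordinates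
`(v̄, w̄) ∈ ℝ^m × ℝ^{d-m}` are the two product components. -/
theorem disk_reparametrization
    (m k : ℕ)
    (V W : Submodule ℝ ((Fin m → ℝ) × (Fin k → ℝ)))
    (hVW : IsCompl V W)
    (hdimV : Module.finrank ℝ V = m)
    (hdimW : Module.finrank ℝ W = k)
    (r₁ r₂ : ℝ) (hr₁ : 0 < r₁) (hr₂ : 0 < r₂)
    (P : Type*) [Nonempty P]
    (g : V → W) (gε : ℝ → P → V → W)
    -- `g` is a `C¹` disk with values in `B₂`
    (hg : ContDiffOn ℝ 1 g (ball 0 r₁))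
    (hgmap : ∀ v ∈ ball (0 : V) r₁, g v ∈ ball (0 : W) r₂)
    -- the `gε(η,·)` are `C¹` disks with values in `B₂`
    (hgε : ∀ ε : ℝ, 0 < ε → ∀ η : P,
      ContDiffOn ℝ 1 (gε ε η) (ball 0 r₁) ∧
      ∀ v ∈ ball (0 : V) r₁, gε ε η v ∈ ball (0 : W) r₂)
    -- `C¹` convergence of `gε` to `g`, uniformly in `η ∈ P` and `v ∈ B₁`, as `ε → 0`
    (hconv : ∀ δ : ℝ, 0 < δ → ∃ ε₁ : ℝ, 0 < ε₁ ∧ ∀ ε : ℝ, 0 < ε → ε ≤ ε₁ → ∀ η : P,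
      ∀ v ∈ ball (0 : V) r₁,
        ‖gε ε η v - g v‖ + ‖fderiv ℝ (gε ε η) v - fderiv ℝ g v‖ ≤ δ)
    -- `z₀ = v₀ + g(v₀) ∈ graph(g)`
    (v₀ : V) (hv₀ : v₀ ∈ ball (0 : V) r₁)
    (z₀ : (Fin m → ℝ) × (Fin k → ℝ)) (hz₀ : z₀ = ↑v₀ + ↑(g v₀))
    -- an invertible matrix mapping `ℝ^m × {0}` onto the tangent space `T_{z₀} g`
    (M : ((Fin m → ℝ) × (Fin k → ℝ)) ≃L[ℝ] ((Fin m → ℝ) × (Fin k → ℝ)))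
    (hM : M '' {p | p.2 = 0} =
      {p : (Fin m → ℝ) × (Fin k → ℝ) | ∃ v : V, p = ↑v + ↑(fderiv ℝ g v₀ v)})
    (L ρ : ℝ) (hL : 0 < L) (hρ : 0 < ρ) :
    ∃ ε₀ : ℝ, 0 < ε₀ ∧ ∃ δ₁ : ℝ, 0 < δ₁ ∧ ∃ δ₂ : ℝ, 0 < δ₂ ∧ δ₂ ≤ ρ ∧
      ∀ ε : ℝ, 0 < ε → ε ≤ ε₀ → ∀ η : P,
        ∃ h : (Fin m → ℝ) → (Fin k → ℝ),
          LipschitzOnWith (Real.toNNReal L) h (ball 0 δ₁) ∧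
          (∀ x ∈ ball (0 : Fin m → ℝ) δ₁, h x ∈ ball (0 : Fin k → ℝ) δ₂) ∧
          (∀ x ∈ ball (0 : Fin m → ℝ) δ₁,
            ∃ v ∈ ball (0 : V) r₁, M (x, h x) = ↑v + ↑(gε ε η v) - z₀) := by
  obtain ⟨A, hA⟩ :=
    exists_continuousLinearEquiv_of_image_eq_tangentSpace hVW.disjoint (fderiv ℝ g v₀) M hM
  obtain ⟨N, hN, hAN⟩ : ∃ N : ℝ, 0 < N ∧ ∀ y, ‖A.symm y‖ ≤ N * ‖y‖ :=
    (A.symm : (Fin m → ℝ) →L[ℝ] V).bound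
  obtain ⟨K, hK, hMK⟩ : ∃ K : ℝ, 0 < K ∧ ∀ p, ‖M.symm p‖ ≤ K * ‖p‖ :=
    (M.symm : ((Fin m → ℝ) × (Fin k → ℝ)) →L[ℝ] ((Fin m → ℝ) × (Fin k → ℝ))).bound
  obtain ⟨c, hc, hNc, hcL⟩ : ∃ c : ℝ, 0 < c ∧ N * c ≤ 1 / 2 ∧ 2 * N * c ≤ L := by
    refine ⟨min 1 L / (2 * N), by positivity, ?_, ?_⟩
    · rw [mul_div_assoc', div_le_iff₀ (by positivity)]
      nlinarith [min_le_left 1 L]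
    · rw [mul_div_cancel₀ _ (by positivity)]
      exact min_le_right 1 L
  obtain ⟨s, hs, hsub, hDg, hcs⟩ : ∃ s : ℝ, 0 < s ∧ closedBall v₀ s ⊆ ball 0 r₁ ∧
      (∀ v ∈ closedBall v₀ s, ‖fderiv ℝ g v - fderiv ℝ g v₀‖ ≤ c / (2 * K)) ∧ c * s ≤ ρ / 4 := by
    have hcont : ContinuousAt (fderiv ℝ g) v₀ :=
      (hg.continuousOn_fderiv_of_isOpen isOpen_ball le_rfl).continuousAt (isOpen_ball.mem_nhds hv₀)
    have hnear : ∀ᶠ v in nhds v₀, fderiv ℝ g v ∈ closedBall (fderiv ℝ g v₀) (c / (2 * K)) :=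
      hcont (closedBall_mem_nhds (fderiv ℝ g v₀) (by positivity))
    obtain ⟨s, hs, hsub⟩ :=
      nhds_basis_closedBall.mem_iff.1 (hnear.and (isOpen_ball.mem_nhds hv₀))
    have hsub' : closedBall v₀ (min s (ρ / (4 * c))) ⊆ closedBall v₀ s :=
      closedBall_subset_closedBall (min_le_left _ _)
    refine ⟨min s (ρ / (4 * c)), by positivity, fun v hv => (hsub (hsub' hv)).2,
      fun v hv => (dist_eq_norm (fderiv ℝ g v) (fderiv ℝ g v₀)).symm.trans_le
        (hsub (hsub' hv)).1, ?_⟩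
    calc c * min s (ρ / (4 * c)) ≤ c * (ρ / (4 * c)) :=
          mul_le_mul_of_nonneg_left (min_le_right _ _) hc.le
      _ = ρ / 4 := by field_simp
  obtain ⟨t, ht, htρ, hts⟩ : ∃ t : ℝ, 0 < t ∧ t ≤ ρ / 4 ∧ t ≤ s / (4 * N) :=
    ⟨min (ρ / 4) (s / (4 * N)), by positivity, min_le_left _ _, min_le_right _ _⟩
  obtain ⟨ε₀, hε₀, hε₀'⟩ := hconv (min (c / (2 * K)) (t / K)) (by positivity)
  refine ⟨ε₀, hε₀, s / (4 * N), by positivity, ρ, hρ, le_rfl, fun ε hε hεε₀ η => ?_⟩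
  set f := gε ε η
  have hC1 := hε₀' ε hε hεε₀ η
  have hdiff : ∀ v ∈ ball (0 : V) r₁, DifferentiableAt ℝ f v := fun v hv =>
    ((hgε ε hε η).1.differentiableOn one_ne_zero).differentiableAt (isOpen_ball.mem_nhds hv)
  let Φ : V → (Fin m → ℝ) × (Fin k → ℝ) := fun v => M.symm (↑v + ↑(f v) - z₀)
  have hΦ : ∀ v ∈ closedBall v₀ s, ∀ v' ∈ closedBall v₀ s,
      ‖Φ v - Φ v' - (A (v - v'), 0)‖ ≤ c * ‖v - v'‖ := by
    intro v hv v' hv'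
    have hrep : Φ v - Φ v' - (A (v - v'), 0) =
        M.symm (f v - f v' - fderiv ℝ g v₀ (v - v') : W) := by
      rw [← hA, ← map_sub, ← map_sub]
      congr 1
      simp only [Submodule.coe_sub]
      abel
    have hlip := norm_sub_sub_fderiv_le_of_fderiv_sub_le (convex_closedBall v₀ s)
      (fun v hv => hdiff v (hsub hv))
      (fun v hv => (le_add_of_nonneg_left (norm_nonneg _)).trans
        ((hC1 v (hsub hv)).trans (min_le_left _ _))) hDg hv hv'
    rw [hrep]
    calc _ ≤ K * ‖f v - f v' - fderiv ℝ g v₀ (v - v')‖ := hMK _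
      _ ≤ K * ((c / (2 * K) + c / (2 * K)) * ‖v - v'‖) := mul_le_mul_of_nonneg_left hlip hK.le
      _ = c * ‖v - v'‖ := by field_simp; ring
  have hΦ₀ : ‖Φ v₀‖ ≤ t := by
    have hrep : Φ v₀ = M.symm (f v₀ - g v₀ : W) := by
      simp only [Φ, hz₀, Submodule.coe_sub, add_sub_add_left_eq_sub]
    have hclose : ‖f v₀ - g v₀‖ ≤ t / K :=
      (le_add_of_nonneg_right (norm_nonneg (fderiv ℝ f v₀ - fderiv ℝ g v₀))).trans
      ((hC1 v₀ hv₀).trans (min_le_right _ _))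
    rw [hrep]
    calc _ ≤ K * ‖f v₀ - g v₀‖ := hMK _
      _ ≤ K * (t / K) := mul_le_mul_of_nonneg_left hclose hK.le
      _ = t := mul_div_cancel₀ _ hK.ne'
  obtain ⟨h, hlip, hbound, hgraph⟩ := exists_lipschitzOnWith_graph_of_approximates A
    (fun v => (Φ v).1) (fun v => (Φ v).2) v₀ (δ := s / (4 * N)) hN hc.le hs.le hNc hAN
    (fun v hv v' hv' => (norm_fst_le _).trans (hΦ v hv v' hv'))
    (fun v hv v' hv' => by simpa using (norm_snd_le _).trans (hΦ v hv v' hv'))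
    ((norm_fst_le _).trans hΦ₀) ((norm_snd_le _).trans hΦ₀) (by
      calc 2 * N * (s / (4 * N) + t) ≤ 2 * N * (s / (4 * N) + s / (4 * N)) := by gcongr
        _ = s := by field_simp; ring)
  refine ⟨h, hlip.weaken (Real.toNNReal_le_toNNReal hcL), fun x hx => ?_, fun x hx => ?_⟩
  · rw [mem_ball_zero_iff]
    linarith [hbound x hx]
  · obtain ⟨v, hv, hv₁, hv₂⟩ := hgraph x hx
    refine ⟨v, hsub hv, ?_⟩
    rw [← hv₂, ← hv₁]
    exact M.apply_symm_apply _
end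

section
/- Let ℝ^d = V ⊕ W with dim V = m, let B₁ ⊂ V, B₂ ⊂ W be balls centered at 0, let P be a nonempty parameter set, let g_ε : P × B₁ → B₂ (ε > 0) and g : B₁ → B₂ be C¹ disks with sup_{η∈P} sup_{v∈B₁} (|g_ε(η,v) − g(v)| + ‖D_v g_ε(η,v) − Dg(v)‖) → 0 as ε → 0, let z₀ = v₀ + g(v₀) ∈ graph(g), and let M be an invertible d×d matrix with M·(ℝ^m × {0}) = T_{z₀}g. Then (existence part) there exist ε₀ > 0 and δ₁ > 0 such that for every ε ∈ (0,ε₀], every η ∈ P and every v̄ ∈ ℝ^m with |(v̄,0)| < δ₁ there exists w̄ ∈ ℝ^{d−m} such that the point M·(v̄,w̄) belongs to the translated graph graph(g_ε(η,·)) − z₀. -/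
open Metric Set

/-- A map sufficiently close to an invertible linear map `L` on a closed ball is onto a closed ball
of proportional radius, with constants depending only on `L`. -/
theorem ContinuousLinearEquiv.exists_surjOn_closedBall_of_approximatesLinearOn
    {E F : Type*} [NormedAddCommGroup E] [NormedSpace ℝ E] [CompleteSpace E]
    [NormedAddCommGroup F] [NormedSpace ℝ F] (L : E ≃L[ℝ] F) :
    ∃ c : NNReal, 0 < c ∧ ∀ (f : E → F) (x : E) (ρ : ℝ), 0 ≤ ρ →
      ApproximatesLinearOn f (L : E →L[ℝ] F) (closedBall x ρ) c →
      SurjOn f (closedBall x ρ) (closedBall (f x) (c * ρ)) := by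
  set N : NNReal := ‖(L.symm : F →L[ℝ] E)‖₊ + 1 with hN
  have hNpos : 0 < N := by positivity
  let R : (L : E →L[ℝ] F).NonlinearRightInverse :=
    { toFun := L.symm
      nnnorm := N
      bound' := fun y => by
        refine ((L.symm : F →L[ℝ] E).le_opNorm y).trans ?_
        gcongr
        simp [hN]
      right_inv' := fun y => by simp }
  refine ⟨N⁻¹ / 2, by positivity, fun f x ρ hρ hf => ?_⟩
  have h := hf.surjOn_closedBall_of_nonlinearRightInverse R hρ subset_rfl
  have hc : ((R.nnnorm : ℝ)⁻¹ - ((N⁻¹ / 2 : NNReal) : ℝ)) = ((N⁻¹ / 2 : NNReal) : ℝ) := by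
    change (N : ℝ)⁻¹ - _ = _
    push_cast
    ring
  rwa [hc] at h

/-- Near a point where `fderiv ℝ g` is continuous, every `f` whose derivative is `δ`-close to that
of `g` is approximated by `fderiv ℝ g x₀` with constant `2 * δ`, on a ball independent of `f`. -/
theorem ContinuousAt.exists_approximatesLinearOn_of_norm_fderiv_sub_le
    {E F : Type*} [NormedAddCommGroup E] [NormedSpace ℝ E]
    [NormedAddCommGroup F] [NormedSpace ℝ F] {g : E → F} {x₀ : E} {s : Set E} {δ : NNReal}
    (hg : ContinuousAt (fderiv ℝ g) x₀) (hs : s ∈ nhds x₀) (hδ : 0 < δ) :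
    ∃ ρ : ℝ, 0 < ρ ∧ closedBall x₀ ρ ⊆ s ∧ ∀ f : E → F, (∀ x ∈ s, DifferentiableAt ℝ f x) →
      (∀ x ∈ s, ‖fderiv ℝ f x - fderiv ℝ g x‖ ≤ δ) →
      ApproximatesLinearOn f (fderiv ℝ g x₀) (closedBall x₀ ρ) (2 * δ) := by
  obtain ⟨ρ, hρ, hρsub⟩ := nhds_basis_closedBall.mem_iff.1
    (Filter.inter_mem hs (hg (closedBall_mem_nhds (fderiv ℝ g x₀) (NNReal.coe_pos.2 hδ))))
  refine ⟨ρ, hρ, fun x hx => (hρsub hx).1, fun f hf hfg x hx y hy => ?_⟩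
  refine (convex_closedBall x₀ ρ).norm_image_sub_le_of_norm_fderiv_le'
    (fun z hz => hf z (hρsub hz).1) (fun z hz => ?_) hy hx
  have h₁ := hfg z (hρsub hz).1
  have h₂ : ‖fderiv ℝ g z - fderiv ℝ g x₀‖ ≤ δ := mem_closedBall_iff_norm.1 (hρsub hz).2
  calc ‖fderiv ℝ f z - fderiv ℝ g x₀‖
      ≤ ‖fderiv ℝ f z - fderiv ℝ g z‖ + ‖fderiv ℝ g z - fderiv ℝ g x₀‖ :=
        norm_sub_le_norm_sub_add_norm_sub _ _ _
    _ ≤ δ + δ := add_le_add h₁ h₂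
    _ = _ := (two_mul (δ : ℝ)).symm

/-- Postcomposing with a bounded linear map and adding an affine map preserves linear
approximation. -/
theorem ApproximatesLinearOn.add_clm_comp_sub_const
    {E F G : Type*} [NormedAddCommGroup E] [NormedSpace ℝ E]
    [NormedAddCommGroup F] [NormedSpace ℝ F] [NormedAddCommGroup G] [NormedSpace ℝ G]
    {f : E → F} {f' : E →L[ℝ] F} {s : Set E} {c : NNReal}
    (hf : ApproximatesLinearOn f f' s c) (B : F →L[ℝ] G) (C : E →L[ℝ] G) (b : G) :
    ApproximatesLinearOn (fun x => C x + B (f x) - b) (C + B ∘L f') s (‖B‖₊ * c) := by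
  intro x hx y hy
  have h : C x + B (f x) - b - (C y + B (f y) - b) - (C + B ∘L f') (x - y) =
      B (f x - f y - f' (x - y)) := by
    simp only [add_apply, ContinuousLinearMap.comp_apply, map_sub]
    abel
  rw [h]
  refine (B.le_opNorm _).trans ?_
  push_cast
  rw [mul_assoc]
  exact mul_le_mul_of_nonneg_left (hf x hx y hy) (norm_nonneg B)

/-- If `M` maps `E₁ × {0}` onto the graph of `T : V → W`, where `V ∩ W = 0`, then the linear map
sending `v` to the first block of `M⁻¹ (v + T v)` has trivial kernel. -/
theorem eq_zero_of_fst_symm_graph_eq_zero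
    {E₁ E₂ : Type*} [NormedAddCommGroup E₁] [NormedSpace ℝ E₁]
    [NormedAddCommGroup E₂] [NormedSpace ℝ E₂] {V W : Submodule ℝ (E₁ × E₂)}
    (hVW : Disjoint V W) (T : V →L[ℝ] W) (M : (E₁ × E₂) ≃L[ℝ] (E₁ × E₂))
    (hM : M '' {p | p.2 = 0} = {p : E₁ × E₂ | ∃ v : V, p = ↑v + ↑(T v)}) (v : V)
    (hv : (M.symm (v + T v)).1 = 0) : v = 0 := by
  have hmem : (v + T v : E₁ × E₂) ∈ M '' {p | p.2 = 0} := by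
    rw [hM]
    exact ⟨v, rfl⟩
  obtain ⟨p, hp, hpv⟩ := hmem
  rw [← hpv, M.symm_apply_apply] at hv
  have hp0 : p = 0 := Prod.ext hv hp
  rw [hp0, map_zero] at hpv
  have hvW : (v : E₁ × E₂) ∈ W := by
    rw [eq_neg_of_add_eq_zero_left hpv.symm]
    exact W.neg_mem (T v).2
  exact Subtype.ext (Submodule.disjoint_def.1 hVW v v.2 hvW)

/-- existence part of the disk-reparameterization lemma.
`ℝ^d` is represented as `(Fin m → ℝ) × (Fin k → ℝ)` with `k = d - m`; block coordinates
`(v̄, w̄) ∈ ℝ^m × ℝ^{d-m}` are the two product components. -/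
theorem disk_reparametrization_existence
    (m k : ℕ)
    (V W : Submodule ℝ ((Fin m → ℝ) × (Fin k → ℝ)))
    (hVW : IsCompl V W)
    (hdimV : Module.finrank ℝ V = m)
    (hdimW : Module.finrank ℝ W = k)
    (r₁ r₂ : ℝ) (hr₁ : 0 < r₁) (hr₂ : 0 < r₂)
    (P : Type*) [Nonempty P]
    (g : V → W) (gε : ℝ → P → V → W)
    -- `g` is a `C¹` disk with values in `B₂`
    (hg : ContDiffOn ℝ 1 g (ball 0 r₁))
    (hgmap : ∀ v ∈ ball (0 : V) r₁, g v ∈ ball (0 : W) r₂)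
    -- the `gε(η,·)` are `C¹` disks with values in `B₂`
    (hgε : ∀ ε : ℝ, 0 < ε → ∀ η : P,
      ContDiffOn ℝ 1 (gε ε η) (ball 0 r₁) ∧
      ∀ v ∈ ball (0 : V) r₁, gε ε η v ∈ ball (0 : W) r₂)
    -- `C¹` convergence of `gε` to `g`, uniformly in `η ∈ P` and `v ∈ B₁`, as `ε → 0`
    (hconv : ∀ δ : ℝ, 0 < δ → ∃ ε₁ : ℝ, 0 < ε₁ ∧ ∀ ε : ℝ, 0 < ε → ε ≤ ε₁ → ∀ η : P,
      ∀ v ∈ ball (0 : V) r₁,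
        ‖gε ε η v - g v‖ + ‖fderiv ℝ (gε ε η) v - fderiv ℝ g v‖ ≤ δ)
    -- `z₀ = v₀ + g(v₀) ∈ graph(g)`
    (v₀ : V) (hv₀ : v₀ ∈ ball (0 : V) r₁)
    (z₀ : (Fin m → ℝ) × (Fin k → ℝ)) (hz₀ : z₀ = ↑v₀ + ↑(g v₀))
    -- an invertible matrix mapping `ℝ^m × {0}` onto the tangent space `T_{z₀} g`
    (M : ((Fin m → ℝ) × (Fin k → ℝ)) ≃L[ℝ] ((Fin m → ℝ) × (Fin k → ℝ)))
    (hM : M '' {p | p.2 = 0} =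
      {p : (Fin m → ℝ) × (Fin k → ℝ) | ∃ v : V, p = ↑v + ↑(fderiv ℝ g v₀ v)}) :
    ∃ ε₀ : ℝ, 0 < ε₀ ∧ ∃ δ₁ : ℝ, 0 < δ₁ ∧
      ∀ ε : ℝ, 0 < ε → ε ≤ ε₀ → ∀ η : P, ∀ vb : Fin m → ℝ,
        ‖((vb, 0) : (Fin m → ℝ) × (Fin k → ℝ))‖ < δ₁ →
        ∃ wb : Fin k → ℝ, ∃ v ∈ ball (0 : V) r₁,
          M (vb, wb) = ↑v + ↑(gε ε η v) - z₀ := by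
  set T : V →L[ℝ] W := fderiv ℝ g v₀
  let A : ((Fin m → ℝ) × (Fin k → ℝ)) →L[ℝ] (Fin m → ℝ) :=
    ContinuousLinearMap.fst ℝ (Fin m → ℝ) (Fin k → ℝ) ∘L M.symm.toContinuousLinearMap
  let B : W →L[ℝ] (Fin m → ℝ) := A ∘L W.subtypeL
  let C : V →L[ℝ] (Fin m → ℝ) := A ∘L V.subtypeL
  have hinj : Function.Injective (C + B ∘L T : V →L[ℝ] (Fin m → ℝ)).toLinearMap := by
    rw [injective_iff_map_eq_zero]
    intro v hv
    refine eq_zero_of_fst_symm_graph_eq_zero hVW.disjoint T M hM v ?_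
    rw [map_add]
    exact hv
  let L : V ≃L[ℝ] (Fin m → ℝ) :=
    (LinearEquiv.ofInjectiveOfFinrankEq _ hinj (by simp [hdimV])).toContinuousLinearEquiv
  have hL : (L : V →L[ℝ] (Fin m → ℝ)) = C + B ∘L T := by
    ext1 v
    rfl
  obtain ⟨c, hc, hsurj⟩ := L.exists_surjOn_closedBall_of_approximatesLinearOn
  set b : ℝ := ‖B‖ + 1
  have hb : 0 < b := by positivity
  have hBb : ‖B‖ ≤ b := (lt_add_one _).le
  set δ : ℝ := c / (2 * b) with hδdef
  have hδ : 0 < δ := by positivity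
  have hcont : ContinuousAt (fderiv ℝ g) v₀ :=
    (hg.continuousOn_fderiv_of_isOpen isOpen_ball le_rfl).continuousAt (isOpen_ball.mem_nhds hv₀)
  obtain ⟨ρ, hρ, hρsub, happrox⟩ :=
    hcont.exists_approximatesLinearOn_of_norm_fderiv_sub_le (δ := ⟨δ, hδ.le⟩)
      (isOpen_ball.mem_nhds hv₀) hδ
  set R : ℝ := c * ρ
  have hRpos : 0 < R := by positivity
  obtain ⟨ε₀, hε₀, hclose⟩ := hconv (min δ (R / (2 * b))) (by positivity)
  refine ⟨ε₀, hε₀, R / 2, by positivity, fun ε hε hεle η vb hvb => ?_⟩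
  have hclose' := hclose ε hε hεle η
  have hf := happrox (gε ε η)
    (fun x hx => ((hgε ε hε η).1.differentiableOn one_ne_zero).differentiableAt
      (isOpen_ball.mem_nhds hx))
    (fun x hx => (le_add_of_nonneg_left (norm_nonneg (gε ε η x - g x))).trans
      ((hclose' x hx).trans (min_le_left _ _)))
  have hconst : ‖B‖₊ * (2 * ⟨δ, hδ.le⟩) ≤ c := by
    rw [← NNReal.coe_le_coe]
    change ‖B‖ * (2 * δ) ≤ c
    calc ‖B‖ * (2 * δ) ≤ b * (2 * δ) := by gcongr
      _ = c := by rw [hδdef]; field_simp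
  have hΦ := (hf.add_clm_comp_sub_const B C (A z₀)).mono_num hconst
  rw [← hL] at hΦ
  have hcenter : ‖C v₀ + B (gε ε η v₀) - A z₀‖ ≤ R / 2 := by
    have h : C v₀ + B (gε ε η v₀) - A z₀ = B (gε ε η v₀ - g v₀) := by
      rw [hz₀, map_add, map_sub]
      change A v₀ + A (gε ε η v₀) - (A v₀ + A (g v₀)) = A (gε ε η v₀) - A (g v₀)
      abel
    have h₀ : ‖gε ε η v₀ - g v₀‖ ≤ R / (2 * b) :=
      (le_add_of_nonneg_right (norm_nonneg (fderiv ℝ (gε ε η) v₀ - fderiv ℝ g v₀))).trans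
        ((hclose' v₀ hv₀).trans (min_le_right _ _))
    rw [h]
    calc ‖B (gε ε η v₀ - g v₀)‖ ≤ ‖B‖ * ‖gε ε η v₀ - g v₀‖ := B.le_opNorm _
      _ ≤ b * (R / (2 * b)) := by gcongr
      _ = R / 2 := by field_simp
  have hvb' : ‖vb‖ < R / 2 := (norm_fst_le ((vb, 0) : (Fin m → ℝ) × (Fin k → ℝ))).trans_lt hvb
  obtain ⟨v, hv, hveq⟩ := hsurj _ v₀ ρ hρ.le hΦ (show vb ∈ closedBall _ _ by
    rw [mem_closedBall_iff_norm]
    refine (norm_sub_le _ _).trans ?_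
    linarith)
  refine ⟨(M.symm (v + gε ε η v - z₀)).2, v, hρsub hv, ?_⟩
  rw [← M.eq_symm_apply]
  refine Prod.ext ?_ rfl
  rw [← hveq]
  change A v + A (gε ε η v) - A z₀ = A (v + gε ε η v - z₀)
  rw [map_sub, map_add]
end

section
/- Let ℝ^d = V ⊕ W with dim V = m, let B₁ ⊂ V, B₂ ⊂ W be balls centered at 0, let P be a nonempty parameter set, let g_ε : P × B₁ → B₂ (ε > 0) and g : B₁ → B₂ be C¹ disks with sup_{η∈P} sup_{v∈B₁} (|g_ε(η,v) − g(v)| + ‖D_v g_ε(η,v) − Dg(v)‖) → 0 as ε → 0, let z₀ = v₀ + g(v₀) ∈ graph(g), and let M be an invertible d×d matrix with M·(ℝ^m × {0}) = T_{z₀}g. Then (uniqueness/Lipschitz part) for every L > 0 there exist ε₀ > 0 and δ > 0 such that for all ε ∈ (0,ε₀], η ∈ P and v₁, v₂ ∈ V with |v₁|, |v₂| ≤ δ and v₀+v₁, v₀+v₂ ∈ B₁, writing v_i + g_ε(η, v_i + v₀) − g(v₀) = M·(v̄_i, w̄_i) for i = 1,2, one has |(0, w̄₁ − w̄₂)| ≤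 L·|(v̄₁ − v̄₂, 0)|. In particular, on this neighborhood w̄ is uniquely determined by v̄ and the resulting function v̄ ↦ w̄ is Lipschitz with constant L. -/
open Metric Set

/-- If a continuous linear isomorphism `M` sends `ℝ^m × {0}` onto the range of an expanding map `T`,
then vectors close to the range of `T` have small slope in the coordinates given by `M`. -/
lemma norm_snd_le_of_near_range {F X Y E : Type*}
    [NormedAddCommGroup F] [NormedSpace ℝ F] [NormedAddCommGroup X] [NormedSpace ℝ X]
    [NormedAddCommGroup Y] [NormedSpace ℝ Y] [NormedAddCommGroup E] [NormedSpace ℝ E]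
    (M : (X × Y) ≃L[ℝ] E) (T : F →L[ℝ] E) {K : ℝ} (hK : 0 ≤ K)
    (hT : ∀ h, ‖h‖ ≤ K * ‖T h‖) (hM : ∀ h, (M.symm (T h)).2 = 0) {L : ℝ} (hL : 0 < L) :
    ∃ c : ℝ, 0 < c ∧ ∀ (h : F) (e : E) (x : X) (y : Y), ‖e‖ ≤ c * ‖h‖ →
      M (x, y) = T h + e → ‖y‖ ≤ L * ‖x‖ := by
  set A : ℝ := K * ‖(M : (X × Y) →L[ℝ] E)‖ with hA
  set B : ℝ := ‖(M.symm : E →L[ℝ] (X × Y))‖ with hB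
  have hA0 : 0 ≤ A := by positivity
  have hB0 : 0 ≤ B := norm_nonneg _
  have hl : 0 < min (1 / 2) (L / 2) := lt_min (by norm_num) (by linarith)
  refine ⟨min (1 / 2) (L / 2) / (A * B + 1), by positivity, fun h e x y he hxy => ?_⟩
  set c : ℝ := min (1 / 2) (L / 2) / (A * B + 1) with hc
  have hc0 : 0 < c := by positivity
  have hABc : A * B * c ≤ min (1 / 2) (L / 2) := by
    have h1 : c * (A * B + 1) = min (1 / 2) (L / 2) := div_mul_cancel₀ _ (by positivity)
    linarith
  have hhalf : A * B * c ≤ 1 / 2 := hABc.trans (min_le_left _ _)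
  have hLhalf : A * B * c ≤ L / 2 := hABc.trans (min_le_right _ _)
  have hsplit : (x, y) = M.symm (T h) + M.symm e := by
    rw [← map_add, ← hxy, M.symm_apply_apply]
  have hN : ‖M.symm e‖ ≤ B * (c * ‖h‖) :=
    ((M.symm : E →L[ℝ] (X × Y)).le_opNorm e).trans (by gcongr)
  have hx : x = (M.symm (T h)).1 + (M.symm e).1 := congrArg Prod.fst hsplit
  have hy : y = (M.symm e).2 := by
    simpa [hM h] using congrArg Prod.snd hsplit
  have hy' : ‖y‖ ≤ B * (c * ‖h‖) := by
    rw [hy]; exact (norm_snd_le _).trans hN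
  have hfst : ‖M.symm (T h)‖ ≤ ‖x‖ + B * (c * ‖h‖) := by
    have h1 : ‖M.symm (T h)‖ = ‖(M.symm (T h)).1‖ := by
      rw [Prod.norm_def, hM h, norm_zero, max_eq_left (norm_nonneg _)]
    have h2 : (M.symm (T h)).1 = x - (M.symm e).1 := by rw [hx]; abel
    rw [h1, h2]
    exact (norm_sub_le _ _).trans (by gcongr; exact (norm_fst_le _).trans hN)
  have hTh : ‖T h‖ ≤ ‖(M : (X × Y) →L[ℝ] E)‖ * ‖M.symm (T h)‖ := by
    simpa using (M : (X × Y) →L[ℝ] E).le_opNorm (M.symm (T h))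
  have hh : ‖h‖ ≤ A * (‖x‖ + B * (c * ‖h‖)) :=
    calc ‖h‖ ≤ K * ‖T h‖ := hT h
      _ ≤ K * (‖(M : (X × Y) →L[ℝ] E)‖ * (‖x‖ + B * (c * ‖h‖))) := by
        gcongr
        exact hTh.trans (by gcongr)
      _ = A * (‖x‖ + B * (c * ‖h‖)) := by rw [hA]; ring
  have hh2 : ‖h‖ ≤ 2 * (A * ‖x‖) := by
    nlinarith [mul_le_mul_of_nonneg_right hhalf (norm_nonneg h)]
  calc ‖y‖ ≤ B * (c * ‖h‖) := hy'
    _ ≤ B * (c * (2 * (A * ‖x‖))) := by gcongr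
    _ = 2 * (A * B * c) * ‖x‖ := by ring
    _ ≤ L * ‖x‖ := by gcongr; linarith

/-- A `C¹`-close family of perturbations of a `C¹` map is, near a point, uniformly close to the
derivative of the unperturbed map at that point, up to a small Lipschitz error. -/
lemma exists_uniform_linear_approx {F G P : Type*}
    [NormedAddCommGroup F] [NormedSpace ℝ F] [NormedAddCommGroup G] [NormedSpace ℝ G]
    {U : Set F} (hU : IsOpen U) {g : F → G} {gε : ℝ → P → F → G}
    (hg : ContDiffOn ℝ 1 g U)
    (hgε : ∀ ε : ℝ, 0 < ε → ∀ η : P, DifferentiableOn ℝ (gε ε η) U)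
    (hconv : ∀ δ : ℝ, 0 < δ → ∃ ε₁ : ℝ, 0 < ε₁ ∧ ∀ ε : ℝ, 0 < ε → ε ≤ ε₁ → ∀ η : P,
      ∀ v ∈ U, ‖fderiv ℝ (gε ε η) v - fderiv ℝ g v‖ ≤ δ)
    {v₀ : F} (hv₀ : v₀ ∈ U) {c : ℝ} (hc : 0 < c) :
    ∃ ε₀ : ℝ, 0 < ε₀ ∧ ∃ δ : ℝ, 0 < δ ∧ ∀ ε : ℝ, 0 < ε → ε ≤ ε₀ → ∀ η : P,
      ∀ v₁ ∈ closedBall v₀ δ, ∀ v₂ ∈ closedBall v₀ δ,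
        ‖gε ε η v₁ - gε ε η v₂ - fderiv ℝ g v₀ (v₁ - v₂)‖ ≤ c * ‖v₁ - v₂‖ := by
  obtain ⟨ε₀, hε₀, hclose⟩ := hconv (c / 2) (by positivity)
  have hcont : ContinuousAt (fderiv ℝ g) v₀ :=
    (hg.continuousOn_fderiv_of_isOpen hU le_rfl).continuousAt (hU.mem_nhds hv₀)
  have hnear : ∀ᶠ v in nhds v₀, v ∈ U ∧ dist (fderiv ℝ g v) (fderiv ℝ g v₀) < c / 2 :=
    Filter.Eventually.and (hU.mem_nhds hv₀) (hcont.eventually (ball_mem_nhds _ (by positivity)))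
  obtain ⟨δ, hδ, hball⟩ := nhds_basis_closedBall.eventually_iff.1 hnear
  refine ⟨ε₀, hε₀, δ, hδ, fun ε hε hεle η v₁ h₁ v₂ h₂ => ?_⟩
  refine (convex_closedBall v₀ δ).norm_image_sub_le_of_norm_fderiv_le' (𝕜 := ℝ)
    (fun v hv => (hgε ε hε η).differentiableAt (hU.mem_nhds (hball hv).1))
    (fun v hv => ?_) h₂ h₁
  have h3 := hclose ε hε hεle η v (hball hv).1
  have h4 := (hball hv).2
  rw [dist_eq_norm] at h4
  calc ‖fderiv ℝ (gε ε η) v - fderiv ℝ g v₀‖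
      ≤ ‖fderiv ℝ (gε ε η) v - fderiv ℝ g v‖ + ‖fderiv ℝ g v - fderiv ℝ g v₀‖ :=
        norm_sub_le_norm_sub_add_norm_sub _ _ _
    _ ≤ c := by linarith

/-- uniqueness/Lipschitz part of the disk-reparameterization lemma.
`ℝ^d` is represented as `(Fin m → ℝ) × (Fin k → ℝ)` with `k = d - m`; block coordinates
`(v̄, w̄) ∈ ℝ^m × ℝ^{d-m}` are the two product components. -/
theorem disk_reparametrization_lipschitz
    (m k : ℕ)
    (V W : Submodule ℝ ((Fin m → ℝ) × (Fin k → ℝ)))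
    (hVW : IsCompl V W)
    (hdimV : Module.finrank ℝ V = m)
    (hdimW : Module.finrank ℝ W = k)
    (r₁ r₂ : ℝ) (hr₁ : 0 < r₁) (hr₂ : 0 < r₂)
    (P : Type*) [Nonempty P]
    (g : V → W) (gε : ℝ → P → V → W)
    -- `g` is a `C¹` disk with values in `B₂`
    (hg : ContDiffOn ℝ 1 g (ball 0 r₁))
    (hgmap : ∀ v ∈ ball (0 : V) r₁, g v ∈ ball (0 : W) r₂)
    -- the `gε(η,·)` are `C¹` disks with values in `B₂`
    (hgε : ∀ ε : ℝ, 0 < ε → ∀ η : P,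
      ContDiffOn ℝ 1 (gε ε η) (ball 0 r₁) ∧
      ∀ v ∈ ball (0 : V) r₁, gε ε η v ∈ ball (0 : W) r₂)
    -- `C¹` convergence of `gε` to `g`, uniformly in `η ∈ P` and `v ∈ B₁`, as `ε → 0`
    (hconv : ∀ δ : ℝ, 0 < δ → ∃ ε₁ : ℝ, 0 < ε₁ ∧ ∀ ε : ℝ, 0 < ε → ε ≤ ε₁ → ∀ η : P,
      ∀ v ∈ ball (0 : V) r₁,
        ‖gε ε η v - g v‖ + ‖fderiv ℝ (gε ε η) v - fderiv ℝ g v‖ ≤ δ)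
    -- `z₀ = v₀ + g(v₀) ∈ graph(g)`
    (v₀ : V) (hv₀ : v₀ ∈ ball (0 : V) r₁)
    (z₀ : (Fin m → ℝ) × (Fin k → ℝ)) (hz₀ : z₀ = ↑v₀ + ↑(g v₀))
    -- an invertible matrix mapping `ℝ^m × {0}` onto the tangent space `T_{z₀} g`
    (M : ((Fin m → ℝ) × (Fin k → ℝ)) ≃L[ℝ] ((Fin m → ℝ) × (Fin k → ℝ)))
    (hM : M '' {p | p.2 = 0} =
      {p : (Fin m → ℝ) × (Fin k → ℝ) | ∃ v : V, p = ↑v + ↑(fderiv ℝ g v₀ v)})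
    (L : ℝ) (hL : 0 < L) :
    ∃ ε₀ : ℝ, 0 < ε₀ ∧ ∃ δ : ℝ, 0 < δ ∧
      ∀ ε : ℝ, 0 < ε → ε ≤ ε₀ → ∀ η : P, ∀ v₁ v₂ : V,
        ‖v₁‖ ≤ δ → ‖v₂‖ ≤ δ →
        v₀ + v₁ ∈ ball (0 : V) r₁ → v₀ + v₂ ∈ ball (0 : V) r₁ →
        ∀ vb₁ wb₁ vb₂ wb₂,
          M (vb₁, wb₁) = ↑v₁ + ↑(gε ε η (v₀ + v₁)) - ↑(g v₀) →
          M (vb₂, wb₂) = ↑v₂ + ↑(gε ε η (v₀ + v₂)) - ↑(g v₀) →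
          ‖((0, wb₁ - wb₂) : (Fin m → ℝ) × (Fin k → ℝ))‖ ≤
            L * ‖((vb₁ - vb₂, 0) : (Fin m → ℝ) × (Fin k → ℝ))‖ := by
  set A : V →L[ℝ] W := fderiv ℝ g v₀ with hA
  let T : V →L[ℝ] ((Fin m → ℝ) × (Fin k → ℝ)) := V.subtypeL + W.subtypeL.comp A
  have hTapply : ∀ v : V, T v = ↑v + ↑(A v) := fun v => rfl
  have hTinj : Function.Injective T := by
    refine (injective_iff_map_eq_zero T).2 fun v hv => ?_
    rw [hTapply] at hv
    have hvW : (v : (Fin m → ℝ) × (Fin k → ℝ)) ∈ W := by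
      rw [eq_neg_of_add_eq_zero_left hv]
      exact W.neg_mem (A v).2
    exact Subtype.ext (Submodule.disjoint_def.1 hVW.disjoint _ v.2 hvW)
  obtain ⟨K, -, hK⟩ := T.toLinearMap.exists_antilipschitzWith
    (LinearMap.ker_eq_bot.2 hTinj : LinearMap.ker T.toLinearMap = ⊥)
  have hTsnd : ∀ h, (M.symm (T h)).2 = 0 := by
    intro h
    have hmem : T h ∈ M '' {p | p.2 = 0} := by
      rw [hM]; exact ⟨h, rfl⟩
    obtain ⟨p, hp, hpT⟩ := hmem
    rw [← hpT, M.symm_apply_apply]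
    exact hp
  obtain ⟨c, hc, hslope⟩ := norm_snd_le_of_near_range M T K.2
    (fun h => ZeroHomClass.bound_of_antilipschitz T.toLinearMap hK h) hTsnd hL
  obtain ⟨ε₀, hε₀, δ, hδ, happrox⟩ := exists_uniform_linear_approx isOpen_ball hg
    (fun ε hε η => (hgε ε hε η).1.differentiableOn one_ne_zero)
    (fun δ hδ => by
      obtain ⟨ε₁, hε₁, h⟩ := hconv δ hδ
      exact ⟨ε₁, hε₁, fun ε hε hεle η v hv =>
        (le_add_of_nonneg_left (norm_nonneg _)).trans (h ε hε hεle η v hv)⟩)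
    hv₀ hc
  refine ⟨ε₀, hε₀, δ, hδ, fun ε hε hεle η v₁ v₂ h₁ h₂ _ _ vb₁ wb₁ vb₂ wb₂ e₁ e₂ => ?_⟩
  have herr := happrox ε hε hεle η (v₀ + v₁) (by simpa using h₁) (v₀ + v₂) (by simpa using h₂)
  rw [add_sub_add_left_eq_sub] at herr
  have hfinal := hslope (v₁ - v₂)
    ((gε ε η (v₀ + v₁) - gε ε η (v₀ + v₂) - A (v₁ - v₂) : W) : (Fin m → ℝ) × (Fin k → ℝ))
    (vb₁ - vb₂) (wb₁ - wb₂) herr (by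
    rw [← Prod.mk_sub_mk, map_sub, e₁, e₂, hTapply]
    push_cast
    abel)
  simpa [Prod.norm_def] using hfinal
end

section
/- Let ℝ^d = V ⊕ W where dim V = n and dim W = d−n, let g : B₁ → B₂ be a C¹ disk between balls B₁ ⊂ V and B₂ ⊂ W, and let G : ℝ^d → ℝ^d be a C¹ mapping. Assume z₀ ∈ graph(g) is such that DG(z₀) is invertible, and let M be an invertible d×d matrix with M·({0}_{d−n} × ℝ^n) equal to the tangent space T_{G(z₀)}(G ∘ (Id + g)) = DG(z₀)·T_{z₀}g. Then for every L > 0 there exist δ₃, δ₄ > 0, balls B(0,δ₃) ⊂ {0}_{d−n} × ℝ^n and B(0,δ₄) ⊂ ℝ^{d−n} × {0}_n, and a map h : B(0,δ₃) → B(0,δ₄), Lipschitz with constant L, such that M·graph(h) ⊆ G(graph(g)) − G(z₀); moreover, for every ρ > 0 the constant δ₃ can be chosen so that additionally δ₄ ≤ ρ·δ₃. -/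
open Metric Set

/-- If the strict derivative of `F : X → P × Q` at a zero `v₀` is an isomorphism onto `{0} × Q`, then
near `0` the image of `F` contains the graph of a map with arbitrarily small Lipschitz constant. -/
theorem HasStrictFDerivAt.exists_lipschitz_graph {X P Q : Type*}
    [NormedAddCommGroup X] [NormedSpace ℝ X] [CompleteSpace X]
    [NormedAddCommGroup P] [NormedSpace ℝ P] [NormedAddCommGroup Q] [NormedSpace ℝ Q]
    {F : X → P × Q} {F' : X →L[ℝ] P × Q} {v₀ : X} (hF : HasStrictFDerivAt F F' v₀)
    (hF₀ : F v₀ = 0) (A : X ≃L[ℝ] Q) (hA : ∀ v, F' v = (0, A v))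
    {U : Set X} (hU : U ∈ nhds v₀) {K : NNReal} (hK : 0 < K) :
    ∃ δ : ℝ, 0 < δ ∧ ∃ h : Q → P, h 0 = 0 ∧ LipschitzOnWith K h (ball 0 δ) ∧
      ∀ x ∈ ball (0 : Q) δ, ∃ v ∈ U, F v = (h x, x) := by
  have h2 : HasStrictFDerivAt (fun v => (F v).2) (A : X →L[ℝ] Q) v₀ := by
    convert hF.snd using 1
    ext v
    simp [hA]
  have h1 : HasStrictFDerivAt (fun v => (F v).1) (0 : X →L[ℝ] P) v₀ := by
    convert hF.fst using 1
    ext v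
    simp [hA]
  set ψ := h2.localInverse _ _ _
  have hF2 : (F v₀).2 = 0 := by simp [hF₀]
  have hψ0 : ψ 0 = v₀ := by
    rw [← hF2]
    exact h2.localInverse_apply_image
  have hψ' : HasStrictFDerivAt ψ (A.symm : Q →L[ℝ] X) 0 := by
    rw [← hF2]
    exact h2.to_localInverse
  have hright : ∀ᶠ y in nhds (0 : Q), (F (ψ y)).2 = y := by
    rw [← hF2]
    exact h2.eventually_right_inverse
  have hmem : ∀ᶠ y in nhds (0 : Q), ψ y ∈ U :=
    hψ'.continuousAt.eventually_mem (by rwa [hψ0])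
  have hh : HasStrictFDerivAt (fun y => (F (ψ y)).1) (0 : Q →L[ℝ] P) 0 := by
    rw [← hψ0] at h1
    simpa using h1.comp (0 : Q) hψ'
  obtain ⟨s, hs, hLip⟩ := hh.exists_lipschitzOnWith_of_nnnorm_lt K (by simpa using hK)
  obtain ⟨δ, hδ, hball⟩ := Metric.eventually_nhds_iff_ball.1
    ((hright.and hmem).and (Filter.eventually_mem_set.2 hs))
  exact ⟨δ, hδ, fun y => (F (ψ y)).1, by simp [hψ0, hF₀],
    hLip.mono fun y hy => (hball y hy).2,
    fun x hx => ⟨ψ x, (hball x hx).1.2, Prod.ext rfl (hball x hx).1.1⟩⟩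

/-- transport of a disk by a `C¹` mapping.
`ℝ^d` is represented as `(Fin k → ℝ) × (Fin n → ℝ)` with `k = d - n`; block coordinates
`(w̄, v̄) ∈ ℝ^{d-n} × ℝ^n` are the two product components, so `{0}_{d-n} × ℝ^n = {p | p.1 = 0}`. -/
theorem disk_transport
    (n k : ℕ)
    (V W : Submodule ℝ ((Fin k → ℝ) × (Fin n → ℝ)))
    (hVW : IsCompl V W)
    (hdimV : Module.finrank ℝ V = n)
    (hdimW : Module.finrank ℝ W = k)
    (r₁ r₂ : ℝ) (hr₁ : 0 < r₁) (hr₂ : 0 < r₂)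
    (g : V → W)
    -- `g` is a `C¹` disk with values in `B₂`
    (hg : ContDiffOn ℝ 1 g (ball 0 r₁))
    (hgmap : ∀ v ∈ ball (0 : V) r₁, g v ∈ ball (0 : W) r₂)
    -- `G` is a `C¹` mapping
    (G : (Fin k → ℝ) × (Fin n → ℝ) → (Fin k → ℝ) × (Fin n → ℝ))
    (hG : ContDiff ℝ 1 G)
    -- `z₀ = v₀ + g(v₀) ∈ graph(g)` with `DG(z₀)` invertible
    (v₀ : V) (hv₀ : v₀ ∈ ball (0 : V) r₁)
    (z₀ : (Fin k → ℝ) × (Fin n → ℝ)) (hz₀ : z₀ = ↑v₀ + ↑(g v₀))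
    (hDG : Function.Bijective (fderiv ℝ G z₀))
    -- an invertible matrix mapping `{0} × ℝ^n` onto `T_{G(z₀)}(G ∘ (Id + g)) = DG(z₀)·T_{z₀}g`
    (M : ((Fin k → ℝ) × (Fin n → ℝ)) ≃L[ℝ] ((Fin k → ℝ) × (Fin n → ℝ)))
    (hM : M '' {p | p.1 = 0} =
      {p : (Fin k → ℝ) × (Fin n → ℝ) |
        ∃ v : V, p = fderiv ℝ G z₀ (↑v + ↑(fderiv ℝ g v₀ v))})
    (L ρ : ℝ) (hL : 0 < L) (hρ : 0 < ρ) :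
    ∃ δ₃ : ℝ, 0 < δ₃ ∧ ∃ δ₄ : ℝ, 0 < δ₄ ∧ δ₄ ≤ ρ * δ₃ ∧
      ∃ h : (Fin n → ℝ) → (Fin k → ℝ),
        LipschitzOnWith (Real.toNNReal L) h (ball 0 δ₃) ∧
        (∀ x ∈ ball (0 : Fin n → ℝ) δ₃, h x ∈ ball (0 : Fin k → ℝ) δ₄) ∧
        (∀ x ∈ ball (0 : Fin n → ℝ) δ₃,
          ∃ v ∈ ball (0 : V) r₁, M (h x, x) = G (↑v + ↑(g v)) - G z₀) := by
  have hstrict_g : HasStrictFDerivAt g (fderiv ℝ g v₀) v₀ :=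
    (hg.contDiffAt (isOpen_ball.mem_nhds hv₀)).hasStrictFDerivAt one_ne_zero
  have hstrict_graph : HasStrictFDerivAt
      (fun v : V => (v : (Fin k → ℝ) × (Fin n → ℝ)) + (g v : (Fin k → ℝ) × (Fin n → ℝ)))
      (V.subtypeL + W.subtypeL.comp (fderiv ℝ g v₀)) v₀ :=
    V.subtypeL.hasStrictFDerivAt.add (W.subtypeL.hasStrictFDerivAt.comp v₀ hstrict_g)
  have hstrict_G : HasStrictFDerivAt G (fderiv ℝ G z₀)
      ((v₀ : (Fin k → ℝ) × (Fin n → ℝ)) + (g v₀ : (Fin k → ℝ) × (Fin n → ℝ))) := by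
    rw [← hz₀]
    exact hG.contDiffAt.hasStrictFDerivAt one_ne_zero
  set T : V →L[ℝ] (Fin k → ℝ) × (Fin n → ℝ) :=
    (fderiv ℝ G z₀).comp (V.subtypeL + W.subtypeL.comp (fderiv ℝ g v₀))
  have hF := (M.symm : _ →L[ℝ] (Fin k → ℝ) × (Fin n → ℝ)).hasStrictFDerivAt.comp v₀
    ((hstrict_G.comp v₀ hstrict_graph).sub_const (G z₀))
  have hTapply (v : V) : T v = fderiv ℝ G z₀ (↑v + ↑(fderiv ℝ g v₀ v)) := rfl
  have hTinj (v : V) (hv : T v = 0) : v = 0 := by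
    have hsum : (v : (Fin k → ℝ) × (Fin n → ℝ)) + ↑(fderiv ℝ g v₀ v) = 0 :=
      hDG.1 (by rw [← hTapply, hv, map_zero])
    have hvW : (v : (Fin k → ℝ) × (Fin n → ℝ)) ∈ W := by
      rw [eq_neg_of_add_eq_zero_left hsum]
      exact W.neg_mem (fderiv ℝ g v₀ v).2
    exact Subtype.ext (Submodule.disjoint_def.1 hVW.disjoint _ v.2 hvW)
  have hfst (v : V) : (M.symm (T v)).1 = 0 := by
    have hv : T v ∈ M '' {p | p.1 = 0} := by
      rw [hM]
      exact ⟨v, rfl⟩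
    obtain ⟨p, hp, hpv⟩ := hv
    rw [← hpv, M.symm_apply_apply]
    exact hp
  let A₀ : V →ₗ[ℝ] (Fin n → ℝ) :=
    LinearMap.snd ℝ (Fin k → ℝ) (Fin n → ℝ) ∘ₗ M.symm.toLinearEquiv.toLinearMap ∘ₗ
      T.toLinearMap
  have hA₀inj : Function.Injective A₀ := by
    refine (injective_iff_map_eq_zero A₀).2 fun v hv => hTinj v ?_
    exact M.symm.map_eq_zero_iff.1 (Prod.ext (hfst v) hv)
  let A : V ≃L[ℝ] (Fin n → ℝ) :=
    (LinearEquiv.ofInjectiveOfFinrankEq A₀ hA₀inj (by simp [hdimV])).toContinuousLinearEquiv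
  have hK : 0 < Real.toNNReal (min L ρ) := Real.toNNReal_pos.2 (lt_min hL hρ)
  obtain ⟨δ, hδ, h, h0, hLip, hgraph⟩ := hF.exists_lipschitz_graph (by simp [← hz₀]) A
    (fun v => Prod.ext (hfst v) rfl) (isOpen_ball.mem_nhds hv₀) hK
  refine ⟨δ, hδ, ρ * δ, mul_pos hρ hδ, le_rfl, h,
    hLip.weaken (Real.toNNReal_le_toNNReal (min_le_left _ _)), fun x hx => ?_, fun x hx => ?_⟩
  · have hle := hLip.dist_le_mul x hx 0 (mem_ball_self hδ)
    rw [h0, Real.coe_toNNReal _ (lt_min hL hρ).le] at hle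
    calc dist (h x) 0 ≤ min L ρ * dist x 0 := hle
      _ ≤ ρ * dist x 0 := by gcongr; exact min_le_right _ _
      _ < ρ * δ := mul_lt_mul_of_pos_left hx hρ
  · obtain ⟨v, hv, hvx⟩ := hgraph x hx
    refine ⟨v, hv, ?_⟩
    rw [← hvx]
    exact M.apply_symm_apply _
end

section
/- Let ℝ^d = V ⊕ W with dim V = n, let g : B₁ → B₂ be a C¹ disk (B₁ ⊂ V, B₂ ⊂ W balls), let G : ℝ^d → ℝ^d be a C¹ mapping, let z₀ = v₀ + g(v₀) ∈ graph(g) with DG(z₀) invertible, and let M be an invertible d×d matrix with M·({0}_{d−n} × ℝ^n) = T_{G(z₀)}(G ∘ (Id + g)). Then (existence part) there exists δ₃ > 0 such that for every v̄ ∈ ℝ^n with |(0,v̄)| < δ₃ there exists v ∈ V with v₀ + v ∈ B₁ and w̄ ∈ ℝ^{d−n} such that M·(w̄, v̄) = G(v₀ + v + g(v₀ + v)) − G(z₀); that is, every point of a small ball in the tangent directions is the tangential projection of a point of the transported disk G(graph(g)) − G(z₀). -/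
open Metric Set

/-- existence part of the disk-transport lemma.
`ℝ^d` is represented as `(Fin k → ℝ) × (Fin n → ℝ)` with `k = d - n`; block coordinates
`(w̄, v̄) ∈ ℝ^{d-n} × ℝ^n` are the two product components. -/
theorem disk_transport_existence
    (n k : ℕ)
    (V W : Submodule ℝ ((Fin k → ℝ) × (Fin n → ℝ)))
    (hVW : IsCompl V W)
    (hdimV : Module.finrank ℝ V = n)
    (hdimW : Module.finrank ℝ W = k)
    (r₁ r₂ : ℝ) (hr₁ : 0 < r₁) (hr₂ : 0 < r₂)
    (g : V → W)
    -- `g` is a `C¹` disk with values in `B₂`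
    (hg : ContDiffOn ℝ 1 g (ball 0 r₁))
    (hgmap : ∀ v ∈ ball (0 : V) r₁, g v ∈ ball (0 : W) r₂)
    -- `G` is a `C¹` mapping
    (G : (Fin k → ℝ) × (Fin n → ℝ) → (Fin k → ℝ) × (Fin n → ℝ))
    (hG : ContDiff ℝ 1 G)
    -- `z₀ = v₀ + g(v₀) ∈ graph(g)` with `DG(z₀)` invertible
    (v₀ : V) (hv₀ : v₀ ∈ ball (0 : V) r₁)
    (z₀ : (Fin k → ℝ) × (Fin n → ℝ)) (hz₀ : z₀ = ↑v₀ + ↑(g v₀))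
    (hDG : Function.Bijective (fderiv ℝ G z₀))
    -- an invertible matrix mapping `{0} × ℝ^n` onto `T_{G(z₀)}(G ∘ (Id + g)) = DG(z₀)·T_{z₀}g`
    (M : ((Fin k → ℝ) × (Fin n → ℝ)) ≃L[ℝ] ((Fin k → ℝ) × (Fin n → ℝ)))
    (hM : M '' {p | p.1 = 0} =
      {p : (Fin k → ℝ) × (Fin n → ℝ) |
        ∃ v : V, p = fderiv ℝ G z₀ (↑v + ↑(fderiv ℝ g v₀ v))}) :
    ∃ δ₃ : ℝ, 0 < δ₃ ∧
      ∀ vb : Fin n → ℝ, ‖((0, vb) : (Fin k → ℝ) × (Fin n → ℝ))‖ < δ₃ →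
        ∃ v : V, v₀ + v ∈ ball (0 : V) r₁ ∧ ∃ wb : Fin k → ℝ,
          M (wb, vb) = G (↑(v₀ + v) + ↑(g (v₀ + v))) - G z₀ := by
  have hgs : HasStrictFDerivAt g (fderiv ℝ g v₀) v₀ :=
    (hg.contDiffAt (isOpen_ball.mem_nhds hv₀)).hasStrictFDerivAt one_ne_zero
  have hGs : HasStrictFDerivAt G (fderiv ℝ G z₀) ((v₀ : (Fin k → ℝ) × (Fin n → ℝ)) + ↑(g v₀)) :=
    hz₀ ▸ hG.contDiffAt.hasStrictFDerivAt one_ne_zero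
  have hgraph : HasStrictFDerivAt (fun u : V => (u : (Fin k → ℝ) × (Fin n → ℝ)) + ↑(g u))
      (V.subtypeL + W.subtypeL.comp (fderiv ℝ g v₀)) v₀ :=
    V.subtypeL.hasStrictFDerivAt.add (W.subtypeL.hasStrictFDerivAt.comp v₀ hgs)
  let P : ((Fin k → ℝ) × (Fin n → ℝ)) →L[ℝ] (Fin n → ℝ) :=
    (ContinuousLinearMap.snd ℝ (Fin k → ℝ) (Fin n → ℝ)).comp M.symm.toContinuousLinearMap
  have hF : HasStrictFDerivAt (fun u : V => P (G (↑u + ↑(g u)) - G z₀))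
      (P.comp ((fderiv ℝ G z₀).comp (V.subtypeL + W.subtypeL.comp (fderiv ℝ g v₀)))) v₀ :=
    P.hasStrictFDerivAt.comp v₀ ((hGs.comp v₀ hgraph).sub_const (G z₀))
  have hsurj : (P.comp ((fderiv ℝ G z₀).comp
      (V.subtypeL + W.subtypeL.comp (fderiv ℝ g v₀)))).range = ⊤ := by
    refine LinearMap.range_eq_top.2 fun vb => ?_
    obtain ⟨v, hv⟩ := hM.subset (mem_image_of_mem M (show ((0, vb) : _ × _).1 = 0 from rfl))
    refine ⟨v, ?_⟩
    change (M.symm (fderiv ℝ G z₀ (↑v + ↑(fderiv ℝ g v₀ v)))).2 = vb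
    rw [← hv, M.symm_apply_apply]
  have hmem : (fun u : V => P (G (↑u + ↑(g u)) - G z₀)) '' ball 0 r₁ ∈ nhds 0 := by
    have h := hF.map_nhds_eq_of_surj hsurj
    rw [← hz₀, sub_self, map_zero] at h
    rw [← h]
    exact Filter.image_mem_map (isOpen_ball.mem_nhds hv₀)
  obtain ⟨δ, hδ, hball⟩ := Metric.mem_nhds_iff.1 hmem
  refine ⟨δ, hδ, fun vb hvb => ?_⟩
  obtain ⟨u, hu, rfl⟩ := hball (mem_ball_zero_iff.2 ((norm_snd_le ((0, vb) : _ × _)).trans_lt hvb))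
  refine ⟨u - v₀, by rwa [add_sub_cancel], (M.symm (G (↑u + ↑(g u)) - G z₀)).1, ?_⟩
  rw [add_sub_cancel]
  exact M.apply_symm_apply _
end

section
/- Let ℝ^d = V ⊕ W with dim V = n, let g : B₁ → B₂ be a C¹ disk (B₁ ⊂ V, B₂ ⊂ W balls), let G : ℝ^d → ℝ^d be a C¹ mapping, let z₀ = v₀ + g(v₀) ∈ graph(g) with DG(z₀) invertible, and let M be an invertible d×d matrix with M·({0}_{d−n} × ℝ^n) = T_{G(z₀)}(G ∘ (Id + g)). Then (Lipschitz part) for every L > 0 there exists δ > 0 such that for all v₁, v₂ ∈ V with |v₁|, |v₂| ≤ δ and v₀+v₁, v₀+v₂ ∈ B₁, writing G(z₀ + v_i + g(v₀+v_i) − g(v₀)) = M·(w̄_i, v̄_i) for i = 1,2, one has |(w̄₁ − w̄₂, 0)| ≤ L·|(0, v̄₁ − v̄₂)|; in particular w̄ is uniquely determined by v̄ there, and the map v̄ ↦ w̄ is Lipschitz with constant L. -/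
open Metric Set

open Filter Topology in
/-- If the derivative of `F` at `x₀` is injective with vanishing first component, then near `x₀`
the first component of `F` is `L`-Lipschitz with respect to the second one. -/
theorem HasStrictFDerivAt.eventually_norm_fst_sub_le {E P Q : Type*}
    [NormedAddCommGroup E] [NormedSpace ℝ E] [FiniteDimensional ℝ E]
    [NormedAddCommGroup P] [NormedSpace ℝ P] [NormedAddCommGroup Q] [NormedSpace ℝ Q]
    {F : E → P × Q} {A : E →L[ℝ] P × Q} {x₀ : E} (hF : HasStrictFDerivAt F A x₀)
    (hA : Function.Injective A) (hA₁ : ∀ v, (A v).1 = 0) {L : ℝ} (hL : 0 < L) :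
    ∀ᶠ p in 𝓝 (x₀, x₀), ‖(F p.1).1 - (F p.2).1‖ ≤ L * ‖(F p.1).2 - (F p.2).2‖ := by
  obtain ⟨K, hK, hKA⟩ := A.toLinearMap.injective_iff_antilipschitz.mp hA
  have hK' : (0 : ℝ) < K := hK
  have hε : 0 < L / ((1 + L) * K) := by positivity
  filter_upwards [hF.isLittleO.def hε] with p hp
  have hlow : ‖p.1 - p.2‖ ≤ K * ‖(A (p.1 - p.2)).2‖ := by
    have hn : ‖A (p.1 - p.2)‖ = ‖(A (p.1 - p.2)).2‖ := by
      rw [Prod.norm_def, hA₁, norm_zero, max_eq_right (norm_nonneg _)]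
    rw [← hn]
    exact ZeroHomClass.bound_of_antilipschitz A.toLinearMap hKA _
  have h₁ := (norm_fst_le _).trans hp
  have h₂ := (norm_snd_le _).trans hp
  simp only [Prod.fst_sub, Prod.snd_sub, hA₁, sub_zero] at h₁ h₂
  have h₃ := norm_sub_norm_le (A (p.1 - p.2)).2 ((F p.1).2 - (F p.2).2)
  rw [norm_sub_rev (A (p.1 - p.2)).2] at h₃
  have hεK : L / ((1 + L) * K) * (1 + L) * K = L := by field_simp
  generalize L / ((1 + L) * K) = ε at *
  have h₄ : ε * (1 + L) * ‖p.1 - p.2‖ ≤ L * ‖(A (p.1 - p.2)).2‖ := by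
    calc ε * (1 + L) * ‖p.1 - p.2‖ ≤ ε * (1 + L) * (K * ‖(A (p.1 - p.2)).2‖) := by gcongr
      _ = L * ‖(A (p.1 - p.2)).2‖ := by rw [← mul_assoc, hεK]
  have h₅ := mul_le_mul_of_nonneg_left (h₃.trans h₂) hL.le
  linarith

/-- Lipschitz part of the disk-transport lemma.
`ℝ^d` is represented as `(Fin k → ℝ) × (Fin n → ℝ)` with `k = d - n`; block coordinates
`(w̄, v̄) ∈ ℝ^{d-n} × ℝ^n` are the two product components. -/
theorem disk_transport_lipschitz
    (n k : ℕ)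
    (V W : Submodule ℝ ((Fin k → ℝ) × (Fin n → ℝ)))
    (hVW : IsCompl V W)
    (hdimV : Module.finrank ℝ V = n)
    (hdimW : Module.finrank ℝ W = k)
    (r₁ r₂ : ℝ) (hr₁ : 0 < r₁) (hr₂ : 0 < r₂)
    (g : V → W)
    -- `g` is a `C¹` disk with values in `B₂`
    (hg : ContDiffOn ℝ 1 g (ball 0 r₁))
    (hgmap : ∀ v ∈ ball (0 : V) r₁, g v ∈ ball (0 : W) r₂)
    -- `G` is a `C¹` mapping
    (G : (Fin k → ℝ) × (Fin n → ℝ) → (Fin k → ℝ) × (Fin n → ℝ))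
    (hG : ContDiff ℝ 1 G)
    -- `z₀ = v₀ + g(v₀) ∈ graph(g)` with `DG(z₀)` invertible
    (v₀ : V) (hv₀ : v₀ ∈ ball (0 : V) r₁)
    (z₀ : (Fin k → ℝ) × (Fin n → ℝ)) (hz₀ : z₀ = ↑v₀ + ↑(g v₀))
    (hDG : Function.Bijective (fderiv ℝ G z₀))
    -- an invertible matrix mapping `{0} × ℝ^n` onto `T_{G(z₀)}(G ∘ (Id + g)) = DG(z₀)·T_{z₀}g`
    (M : ((Fin k → ℝ) × (Fin n → ℝ)) ≃L[ℝ] ((Fin k → ℝ) × (Fin n → ℝ)))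
    (hM : M '' {p | p.1 = 0} =
      {p : (Fin k → ℝ) × (Fin n → ℝ) |
        ∃ v : V, p = fderiv ℝ G z₀ (↑v + ↑(fderiv ℝ g v₀ v))})
    (L : ℝ) (hL : 0 < L) :
    ∃ δ : ℝ, 0 < δ ∧
      ∀ v₁ v₂ : V, ‖v₁‖ ≤ δ → ‖v₂‖ ≤ δ →
        v₀ + v₁ ∈ ball (0 : V) r₁ → v₀ + v₂ ∈ ball (0 : V) r₁ →
        ∀ wb₁ vb₁ wb₂ vb₂,
          G (z₀ + ↑v₁ + ↑(g (v₀ + v₁)) - ↑(g v₀)) = M (wb₁, vb₁) →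
          G (z₀ + ↑v₂ + ↑(g (v₀ + v₂)) - ↑(g v₀)) = M (wb₂, vb₂) →
          ‖((wb₁ - wb₂, 0) : (Fin k → ℝ) × (Fin n → ℝ))‖ ≤
            L * ‖((0, vb₁ - vb₂) : (Fin k → ℝ) × (Fin n → ℝ))‖ := by
  have hgs : HasStrictFDerivAt g (fderiv ℝ g v₀) v₀ :=
    (hg.contDiffAt (isOpen_ball.mem_nhds hv₀)).hasStrictFDerivAt one_ne_zero
  have hgraph : HasStrictFDerivAt
      (fun v : V => (v : (Fin k → ℝ) × (Fin n → ℝ)) + (g v : (Fin k → ℝ) × (Fin n → ℝ)))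
      (V.subtypeL + W.subtypeL.comp (fderiv ℝ g v₀)) v₀ :=
    V.subtypeL.hasStrictFDerivAt.add (W.subtypeL.hasStrictFDerivAt.comp v₀ hgs)
  have hGs : HasStrictFDerivAt G (fderiv ℝ G z₀) ((v₀ : (Fin k → ℝ) × (Fin n → ℝ)) + g v₀) :=
    hz₀ ▸ hG.contDiffAt.hasStrictFDerivAt one_ne_zero
  have hF := M.symm.hasStrictFDerivAt.comp v₀ (hGs.comp v₀ hgraph)
  have hinj : Function.Injective ((M.symm : _ →L[ℝ] (Fin k → ℝ) × (Fin n → ℝ)).comp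
      ((fderiv ℝ G z₀).comp (V.subtypeL + W.subtypeL.comp (fderiv ℝ g v₀)))) := by
    refine M.symm.injective.comp (hDG.injective.comp ?_)
    refine (injective_iff_map_eq_zero _).mpr fun v hv => ?_
    have hv' : (v : (Fin k → ℝ) × (Fin n → ℝ)) + (fderiv ℝ g v₀ v : W) = 0 := hv
    have hvW : (v : (Fin k → ℝ) × (Fin n → ℝ)) ∈ W := by
      rw [eq_neg_of_add_eq_zero_left hv']
      exact W.neg_mem (fderiv ℝ g v₀ v).2
    exact Subtype.ext (Submodule.disjoint_def.mp hVW.disjoint _ v.2 hvW)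
  have hfst : ∀ v, ((M.symm : _ →L[ℝ] (Fin k → ℝ) × (Fin n → ℝ)).comp
      ((fderiv ℝ G z₀).comp (V.subtypeL + W.subtypeL.comp (fderiv ℝ g v₀))) v).1 = 0 := by
    intro v
    obtain ⟨p, hp, hpM⟩ : fderiv ℝ G z₀ (↑v + ↑(fderiv ℝ g v₀ v)) ∈ M '' {p | p.1 = 0} :=
      hM ▸ ⟨v, rfl⟩
    change (M.symm (fderiv ℝ G z₀ (↑v + ↑(fderiv ℝ g v₀ v)))).1 = 0
    rw [← hpM, M.symm_apply_apply]
    exact hp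
  obtain ⟨δ, hδ, hball⟩ := Metric.eventually_nhds_iff.mp
    (hF.eventually_norm_fst_sub_le hinj hfst hL)
  refine ⟨δ / 2, half_pos hδ, fun v₁ v₂ hv₁ hv₂ _ _ wb₁ vb₁ wb₂ vb₂ h₁ h₂ => ?_⟩
  have hdist : dist (v₀ + v₁, v₀ + v₂) (v₀, v₀) < δ := by
    rw [Prod.dist_eq, max_lt_iff, dist_self_add_left, dist_self_add_left]
    constructor <;> linarith
  have key := hball hdist
  have hpt : ∀ v : V, z₀ + (v : (Fin k → ℝ) × (Fin n → ℝ)) + (g (v₀ + v) : W) - (g v₀ : W) =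
      ((v₀ + v : V) : (Fin k → ℝ) × (Fin n → ℝ)) + (g (v₀ + v) : W) := by
    intro v
    rw [hz₀, Submodule.coe_add]
    abel
  rw [hpt] at h₁ h₂
  simpa only [Function.comp_apply, h₁, h₂, M.symm_apply_apply, Prod.norm_mk, norm_zero,
    max_eq_left (norm_nonneg _), max_eq_right (norm_nonneg _)] using key
end

section
/- Under the hypotheses of the extended transport lemma (ℝ^d = V ⊕ W with dim V = n, X a Banach space, g : B₁ → B₂ a C¹ disk, g_ε = (g_{ε,X}, g_{ε,W}) : B₁ → P × B₂ C¹ with ‖Dg_{ε,X}‖ ≤ E(ε) → 0 and g_{ε,W} → g in C¹ uniformly, G_ε = (G_{ε,X}, G_{ε,d}) : X × ℝ^d → X × ℝ^d C¹ with G_{ε,d} → G in C¹ uniformly on P × (B₁+B₂), ‖DG_ε‖ bounded uniformly in ε on bounded sets, z₀ = v₀ + g(v₀) with DG(z₀) invertible, M invertible with M·({0}_{d−n} × ℝ^n) = T_{G(z₀)}(G ∘ (Id + g))), the X-component of the transported disk satisfies a Lipschitz estimate: there exist ε₀, δ > 0 and a constant L₂ such that for all ε ∈ (0,ε₀] and all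 v₁, v₂ ∈ V with |v₁|, |v₂| ≤ δ, setting (η_i, z_i) = (g_{ε,X}(v_i+v₀), v_i+v₀+g_{ε,W}(v_i+v₀)) and G_{ε,d}(η_i,z_i) = M·(w̄_i, v̄_i), one has ‖G_{ε,X}(η₂,z₂) − G_{ε,X}(η₁,z₁)‖_X ≤ L₂·|(0, v̄₂ − v̄₁)|. -/
open Metric Set

open Filter Topology

theorem tendsto_clm_comp {ι E F Y : Type*}
    [NormedAddCommGroup E] [NormedSpace ℝ E] [NormedAddCommGroup F] [NormedSpace ℝ F]
    [NormedAddCommGroup Y] [NormedSpace ℝ Y] {l : Filter ι}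
    {f : ι → F →L[ℝ] Y} {f₀ : F →L[ℝ] Y} {g : ι → E →L[ℝ] F} {g₀ : E →L[ℝ] F}
    (hf : Tendsto f l (𝓝 f₀)) (hg : Tendsto g l (𝓝 g₀)) :
    Tendsto (fun i => (f i).comp (g i)) l (𝓝 (f₀.comp g₀)) :=
  ((continuous_fst.clm_comp continuous_snd).tendsto (f₀, g₀)).comp (hf.prodMk_nhds hg)

/-- If the derivatives of `H ε` converge to `L` as `ε → 0⁺` and `v → v₀`, with `A ∘ L` injective,
and those of `K ε` stay bounded, then near `v₀` the increments of `K ε` are controlled by those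
of `A ∘ H ε`, uniformly in `ε`. -/
theorem exists_norm_sub_le_of_tendsto_fderiv {V E F Y : Type*}
    [NormedAddCommGroup V] [NormedSpace ℝ V] [FiniteDimensional ℝ V]
    [NormedAddCommGroup E] [NormedSpace ℝ E] [NormedAddCommGroup F] [NormedSpace ℝ F]
    [NormedAddCommGroup Y] [NormedSpace ℝ Y]
    {H : ℝ → V → E} {K : ℝ → V → Y} {v₀ : V} {L : V →L[ℝ] E} (A : E →L[ℝ] F) {C : ℝ}
    (hinj : Function.Injective (A.comp L))
    (hH : ∀ᶠ p in 𝓝[>] (0 : ℝ) ×ˢ 𝓝 v₀, DifferentiableAt ℝ (H p.1) p.2)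
    (hL : Tendsto (fun p : ℝ × V => fderiv ℝ (H p.1) p.2) (𝓝[>] (0 : ℝ) ×ˢ 𝓝 v₀) (𝓝 L))
    (hK : ∀ᶠ p in 𝓝[>] (0 : ℝ) ×ˢ 𝓝 v₀, DifferentiableAt ℝ (K p.1) p.2)
    (hC : ∀ᶠ p in 𝓝[>] (0 : ℝ) ×ˢ 𝓝 v₀, ‖fderiv ℝ (K p.1) p.2‖ ≤ C) :
    ∃ ε₀ : ℝ, 0 < ε₀ ∧ ∃ δ : ℝ, 0 < δ ∧ ∃ L₂ : ℝ, 0 ≤ L₂ ∧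
      ∀ ε : ℝ, 0 < ε → ε ≤ ε₀ → ∀ x ∈ closedBall v₀ δ, ∀ y ∈ closedBall v₀ δ,
        ‖K ε y - K ε x‖ ≤ L₂ * ‖A (H ε y - H ε x)‖ := by
  obtain ⟨κ, hκ, hanti⟩ := LinearMap.exists_antilipschitzWith (A.comp L : V →ₗ[ℝ] F)
    (LinearMap.ker_eq_bot.2 hinj)
  have hκ' : (0 : ℝ) < κ := by exact_mod_cast hκ
  have hAL : Tendsto (fun p : ℝ × V => A.comp (fderiv ℝ (H p.1) p.2))
      (𝓝[>] (0 : ℝ) ×ˢ 𝓝 v₀) (𝓝 (A.comp L)) :=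
    tendsto_clm_comp tendsto_const_nhds hL
  have hclose := hAL.eventually (Metric.closedBall_mem_nhds (A.comp L)
    (show (0 : ℝ) < (2 * (κ : ℝ))⁻¹ by positivity))
  obtain ⟨a, ha, b, hb, hab⟩ := eventually_prod_iff.1 (hH.and (hK.and (hC.and hclose)))
  obtain ⟨ε₀, hε₀, hεa⟩ := mem_nhdsGT_iff_exists_Ioc_subset.1 ha
  obtain ⟨δ, hδ, hδb⟩ := Metric.nhds_basis_closedBall.mem_iff.1 hb
  refine ⟨ε₀, hε₀, δ, hδ, |C| * (2 * κ), by positivity, fun ε hε hε' x hx y hy => ?_⟩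
  have hev : ∀ v ∈ closedBall v₀ δ, _ := fun v hv => hab (hεa ⟨hε, hε'⟩) (hδb hv)
  have hconv : Convex ℝ (closedBall v₀ δ) := convex_closedBall _ _
  have hKle : ‖K ε y - K ε x‖ ≤ |C| * ‖y - x‖ :=
    hconv.norm_image_sub_le_of_norm_fderiv_le (𝕜 := ℝ) (fun v hv => (hev v hv).2.1)
      (fun v hv => (hev v hv).2.2.1.trans (le_abs_self C)) hx hy
  have hHle : ‖A (H ε y) - A (H ε x) - A.comp L (y - x)‖ ≤ (2 * (κ : ℝ))⁻¹ * ‖y - x‖ :=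
    hconv.norm_image_sub_le_of_norm_hasFDerivWithin_le' (𝕜 := ℝ) (f := fun v => A (H ε v))
      (fun v hv => (A.hasFDerivAt.comp v (hev v hv).1.hasFDerivAt).hasFDerivWithinAt)
      (fun v hv => by simpa [dist_eq_norm] using (hev v hv).2.2.2) hx hy
  have hlow : ‖y - x‖ ≤ κ * ‖A.comp L (y - x)‖ := by
    simpa [dist_eq_norm] using hanti.le_mul_dist y x
  have htri := norm_sub_norm_le (A.comp L (y - x)) (A (H ε y) - A (H ε x))
  rw [norm_sub_rev (A.comp L (y - x))] at htri
  have hmain : ‖y - x‖ ≤ 2 * κ * ‖A (H ε y - H ε x)‖ := by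
    rw [map_sub]
    have h1 := mul_le_mul_of_nonneg_left (htri.trans hHle) hκ'.le
    have h2 : κ * ((2 * (κ : ℝ))⁻¹ * ‖y - x‖) = ‖y - x‖ / 2 := by field_simp
    rw [h2] at h1
    linarith
  calc _ ≤ |C| * ‖y - x‖ := hKle
    _ ≤ |C| * (2 * κ * ‖A (H ε y - H ε x)‖) := by gcongr
    _ = _ := by ring

theorem eventually_nhdsGT_zero_of_forall_exists {Q : ℝ → Prop}
    (h : ∃ ε₁ : ℝ, 0 < ε₁ ∧ ∀ ε : ℝ, 0 < ε → ε ≤ ε₁ → Q ε) : ∀ᶠ ε in 𝓝[>] (0 : ℝ), Q ε := by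
  obtain ⟨ε₁, hε₁, h⟩ := h
  filter_upwards [Ioc_mem_nhdsGT hε₁] with ε hε using h ε hε.1 hε.2

/-- A quantity that is uniformly close to a function of `u`, together with `u → a` and continuity
of that function at `a`, converges. -/
theorem tendsto_of_forall_eventually_norm_sub_le {ι U E : Type*} [TopologicalSpace U]
    [SeminormedAddCommGroup E] {l : Filter ι} {f : ι → E} {F : U → E} {u : ι → U} {a : U}
    (hF : ContinuousAt F a) (hu : Tendsto u l (𝓝 a))
    (h : ∀ δ : ℝ, 0 < δ → ∀ᶠ i in l, ‖f i - F (u i)‖ ≤ δ) : Tendsto f l (𝓝 (F a)) := by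
  have h0 : Tendsto (fun i => f i - F (u i)) l (𝓝 0) := by
    refine Metric.nhds_basis_closedBall.tendsto_right_iff.2 fun δ hδ => ?_
    simpa using h δ hδ
  simpa using h0.add (hF.tendsto.comp hu)

/-- Lipschitz control of the `X`-component of a transported disk over abstract spaces: the disk is
`v ↦ (gεX ε v, ιV v + ιW (gεW ε v))`, and `A` is injective on the tangent space of the limit. -/
theorem exists_norm_sub_le_of_disk_transport {V W E F X : Type*}
    [NormedAddCommGroup V] [NormedSpace ℝ V] [FiniteDimensional ℝ V]
    [NormedAddCommGroup W] [NormedSpace ℝ W] [NormedAddCommGroup E] [NormedSpace ℝ E]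
    [NormedAddCommGroup F] [NormedSpace ℝ F] [NormedAddCommGroup X] [NormedSpace ℝ X]
    (ιV : V →L[ℝ] E) (ιW : W →L[ℝ] E) {r₁ r₂ : ℝ} {P : Set X} (hPbdd : Bornology.IsBounded P)
    {g : V → W} (hg : ContDiffOn ℝ 1 g (ball 0 r₁))
    {gεX : ℝ → V → X} {gεW : ℝ → V → W}
    (hgε : ∀ ε : ℝ, 0 < ε →
      ContDiffOn ℝ 1 (fun v : V => (gεX ε v, gεW ε v)) (ball 0 r₁) ∧
      ∀ v ∈ ball (0 : V) r₁, gεX ε v ∈ P ∧ gεW ε v ∈ ball (0 : W) r₂)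
    {Ebnd : ℝ → ℝ}
    (hEtend : ∀ δ : ℝ, 0 < δ → ∃ ε₁ : ℝ, 0 < ε₁ ∧ ∀ ε : ℝ, 0 < ε → ε ≤ ε₁ → Ebnd ε ≤ δ)
    (hEbnd : ∀ ε : ℝ, 0 < ε → ∀ v ∈ ball (0 : V) r₁, ‖fderiv ℝ (gεX ε) v‖ ≤ Ebnd ε)
    (hgconv : ∀ δ : ℝ, 0 < δ → ∃ ε₁ : ℝ, 0 < ε₁ ∧ ∀ ε : ℝ, 0 < ε → ε ≤ ε₁ →
      ∀ v ∈ ball (0 : V) r₁,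
        ‖gεW ε v - g v‖ + ‖fderiv ℝ (gεW ε) v - fderiv ℝ g v‖ ≤ δ)
    {GεX : ℝ → X × E → X} {Gεd : ℝ → X × E → E}
    (hGε : ∀ ε : ℝ, 0 < ε → ContDiff ℝ 1 (fun p => (GεX ε p, Gεd ε p)))
    {G : E → E} (hG : ContDiff ℝ 1 G)
    (hGconv : ∀ δ : ℝ, 0 < δ → ∃ ε₁ : ℝ, 0 < ε₁ ∧ ∀ ε : ℝ, 0 < ε → ε ≤ ε₁ → ∀ η ∈ P, ∀ u : E,
      (∃ v ∈ ball (0 : V) r₁, ∃ w ∈ ball (0 : W) r₂, u = ιV v + ιW w) →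
        ‖Gεd ε (η, u) - G u‖ +
          ‖fderiv ℝ (fun u' => Gεd ε (η, u')) u - fderiv ℝ G u‖ ≤ δ)
    (hDGbdd : ∀ S : Set (X × E), Bornology.IsBounded S →
      ∃ C : ℝ, ∀ ε : ℝ, 0 < ε → ∀ p ∈ S,
        ‖fderiv ℝ (fun q => (GεX ε q, Gεd ε q)) p‖ ≤ C)
    {v₀ : V} (hv₀ : v₀ ∈ ball (0 : V) r₁) {z₀ : E} (hz₀ : z₀ = ιV v₀ + ιW (g v₀))
    (A : E →L[ℝ] F)
    (hinj : Function.Injective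
      (A.comp ((fderiv ℝ G z₀).comp (ιV + ιW.comp (fderiv ℝ g v₀))))) :
    ∃ ε₀ : ℝ, 0 < ε₀ ∧ ∃ δ : ℝ, 0 < δ ∧ ∃ L₂ : ℝ, 0 ≤ L₂ ∧
      ∀ ε : ℝ, 0 < ε → ε ≤ ε₀ → ∀ x ∈ closedBall v₀ δ, ∀ y ∈ closedBall v₀ δ,
        ‖GεX ε (gεX ε y, ιV y + ιW (gεW ε y)) - GεX ε (gεX ε x, ιV x + ιW (gεW ε x))‖ ≤
          L₂ * ‖A (Gεd ε (gεX ε y, ιV y + ιW (gεW ε y)) -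
            Gεd ε (gεX ε x, ιV x + ιW (gεW ε x)))‖ := by
  set l := 𝓝[>] (0 : ℝ) ×ˢ 𝓝 v₀ with hl
  have hpos : ∀ᶠ p : ℝ × V in l, 0 < p.1 :=
    (eventually_mem_nhdsWithin (a := (0 : ℝ)) (s := Ioi 0)).prod_inl _
  have hball : ∀ᶠ p : ℝ × V in l, p.2 ∈ ball (0 : V) r₁ :=
    (isOpen_ball.eventually_mem hv₀).prod_inr _
  have hsnd : Tendsto (fun p : ℝ × V => p.2) l (𝓝 v₀) := tendsto_snd
  have hg_at : ContDiffAt ℝ 1 g v₀ := hg.contDiffAt (isOpen_ball.mem_nhds hv₀)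
  have hgε_close : ∀ δ : ℝ, 0 < δ → ∀ᶠ p : ℝ × V in l,
      ‖gεW p.1 p.2 - g p.2‖ + ‖fderiv ℝ (gεW p.1) p.2 - fderiv ℝ g p.2‖ ≤ δ := fun δ hδ => by
    filter_upwards [(eventually_nhdsGT_zero_of_forall_exists (hgconv δ hδ)).prod_inl (𝓝 v₀),
      hball] with p hp hpb using hp p.2 hpb
  have hgW : Tendsto (fun p : ℝ × V => gεW p.1 p.2) l (𝓝 (g v₀)) :=
    tendsto_of_forall_eventually_norm_sub_le hg_at.continuousAt hsnd fun δ hδ =>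
      (hgε_close δ hδ).mono fun p hp => (le_add_of_nonneg_right (by positivity)).trans hp
  have hDgW : Tendsto (fun p : ℝ × V => fderiv ℝ (gεW p.1) p.2) l (𝓝 (fderiv ℝ g v₀)) :=
    tendsto_of_forall_eventually_norm_sub_le (hg_at.continuousAt_fderiv one_ne_zero) hsnd
      fun δ hδ => (hgε_close δ hδ).mono fun p hp =>
        (le_add_of_nonneg_left (norm_nonneg _)).trans hp
  have hDgX : Tendsto (fun p : ℝ × V => fderiv ℝ (gεX p.1) p.2) l (𝓝 0) := by
    refine Metric.nhds_basis_closedBall.tendsto_right_iff.2 fun δ hδ => ?_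
    filter_upwards [(eventually_nhdsGT_zero_of_forall_exists (hEtend δ hδ)).prod_inl (𝓝 v₀),
      hpos, hball] with p hp hp0 hpb
    simpa using (hEbnd p.1 hp0 p.2 hpb).trans hp
  -- the point of the disk and its `E` component
  set u : ℝ × V → E := fun p => ιV p.2 + ιW (gεW p.1 p.2) with hu_def
  have hu : Tendsto u l (𝓝 z₀) := by
    rw [hz₀]
    exact ((ιV.continuous.tendsto v₀).comp hsnd).add
      ((ιW.continuous.tendsto (g v₀)).comp hgW)
  have hT : Tendsto (fun p : ℝ × V =>
      fderiv ℝ (fun u' => Gεd p.1 (gεX p.1 p.2, u')) (u p)) l (𝓝 (fderiv ℝ G z₀)) := by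
    refine tendsto_of_forall_eventually_norm_sub_le
      (hG.continuous_fderiv one_ne_zero).continuousAt hu fun δ hδ => ?_
    filter_upwards [(eventually_nhdsGT_zero_of_forall_exists (hGconv δ hδ)).prod_inl (𝓝 v₀),
      hpos, hball] with p hp hp0 hpb
    have hmem := (hgε p.1 hp0).2 p.2 hpb
    exact (le_add_of_nonneg_left (norm_nonneg _)).trans
      (hp _ hmem.1 (u p) ⟨p.2, hpb, _, hmem.2, rfl⟩)
  obtain ⟨C, hC⟩ := hDGbdd (P ×ˢ closedBall 0 (‖ιV‖ * r₁ + ‖ιW‖ * r₂))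
    (hPbdd.prod isBounded_closedBall)
  have hmemS : ∀ᶠ p : ℝ × V in l,
      (gεX p.1 p.2, u p) ∈ P ×ˢ closedBall 0 (‖ιV‖ * r₁ + ‖ιW‖ * r₂) := by
    filter_upwards [hpos, hball] with p hp0 hpb
    have hmem := (hgε p.1 hp0).2 p.2 hpb
    refine ⟨hmem.1, ?_⟩
    have h1 := mem_ball_zero_iff.1 hpb
    have h2 := mem_ball_zero_iff.1 hmem.2
    rw [mem_closedBall_zero_iff]
    exact (norm_add_le _ _).trans
      (add_le_add (ιV.le_opNorm_of_le h1.le) (ιW.le_opNorm_of_le h2.le))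
  have hGX_diff : ∀ ε : ℝ, 0 < ε → Differentiable ℝ (GεX ε) := fun ε hε =>
    ((hGε ε hε).differentiable one_ne_zero).fst
  have hGd_diff : ∀ ε : ℝ, 0 < ε → Differentiable ℝ (Gεd ε) := fun ε hε =>
    ((hGε ε hε).differentiable one_ne_zero).snd
  have hC' : ∀ᶠ p : ℝ × V in l, ‖fderiv ℝ (GεX p.1) (gεX p.1 p.2, u p)‖ ≤ C ∧
      ‖fderiv ℝ (Gεd p.1) (gεX p.1 p.2, u p)‖ ≤ C := by
    filter_upwards [hpos, hmemS] with p hp0 hpS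
    have h := hC p.1 hp0 _ hpS
    rw [DifferentiableAt.fderiv_prodMk (hGX_diff _ hp0 _) (hGd_diff _ hp0 _),
      ContinuousLinearMap.opNorm_prod, Prod.norm_def] at h
    exact max_le_iff.1 h
  -- derivative of the disk
  set S : ℝ × V → V →L[ℝ] E := fun p =>
    ιV + ιW.comp (fderiv ℝ (gεW p.1) p.2) with hS_def
  set S₀ : V →L[ℝ] E :=
    ιV + ιW.comp (fderiv ℝ g v₀) with hS₀_def
  have hS : Tendsto S l (𝓝 S₀) := tendsto_const_nhds.add (tendsto_clm_comp tendsto_const_nhds hDgW)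
  have hdisk : ∀ᶠ p : ℝ × V in l, HasFDerivAt
      (fun v : V => (gεX p.1 v, ιV v + ιW (gεW p.1 v)))
      ((fderiv ℝ (gεX p.1) p.2).prod (S p)) p.2 := by
    filter_upwards [hpos, hball] with p hp0 hpb
    have hd := ((hgε p.1 hp0).1.contDiffAt (isOpen_ball.mem_nhds hpb)).differentiableAt one_ne_zero
    exact hd.fst.hasFDerivAt.prodMk
      (ιV.hasFDerivAt.add (ιW.hasFDerivAt.comp p.2 hd.snd.hasFDerivAt))
  set H : ℝ → V → E := fun ε v =>
    Gεd ε (gεX ε v, ιV v + ιW (gεW ε v)) with hH_def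
  set K : ℝ → V → X := fun ε v => GεX ε (gεX ε v, ιV v + ιW (gεW ε v)) with hK_def
  have hH : ∀ᶠ p : ℝ × V in l, HasFDerivAt (H p.1) ((fderiv ℝ (Gεd p.1) (gεX p.1 p.2, u p)).comp
      ((fderiv ℝ (gεX p.1) p.2).prod (S p))) p.2 := by
    filter_upwards [hpos, hdisk] with p hp0 hp
    exact (hGd_diff _ hp0 _).hasFDerivAt.comp p.2 hp
  have hK : ∀ᶠ p : ℝ × V in l, HasFDerivAt (K p.1) ((fderiv ℝ (GεX p.1) (gεX p.1 p.2, u p)).comp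
      ((fderiv ℝ (gεX p.1) p.2).prod (S p))) p.2 := by
    filter_upwards [hpos, hdisk] with p hp0 hp
    exact (hGX_diff _ hp0 _).hasFDerivAt.comp p.2 hp
  have hXpart : Tendsto (fun p : ℝ × V => (fderiv ℝ (Gεd p.1) (gεX p.1 p.2, u p)).comp
      ((fderiv ℝ (gεX p.1) p.2).prod 0)) l (𝓝 0) := by
    have hlim : Tendsto (fun p : ℝ × V => C * ‖fderiv ℝ (gεX p.1) p.2‖) l (𝓝 0) := by
      simpa using hDgX.norm.const_mul C
    refine squeeze_zero_norm' ?_ hlim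
    filter_upwards [hC'] with p hp
    refine (ContinuousLinearMap.opNorm_comp_le _ _).trans ?_
    rw [ContinuousLinearMap.opNorm_prod, Prod.norm_def, norm_zero, max_eq_left (norm_nonneg _)]
    exact mul_le_mul_of_nonneg_right hp.2 (norm_nonneg _)
  have hHlim : Tendsto (fun p : ℝ × V => fderiv ℝ (H p.1) p.2) l
      (𝓝 ((fderiv ℝ G z₀).comp S₀)) := by
    have hsum := hXpart.add (tendsto_clm_comp hT hS)
    rw [zero_add] at hsum
    refine hsum.congr' ?_
    filter_upwards [hpos, hH] with p hp0 hp
    have hpartial : fderiv ℝ (fun u' => Gεd p.1 (gεX p.1 p.2, u')) (u p) =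
        (fderiv ℝ (Gεd p.1) (gεX p.1 p.2, u p)).comp (ContinuousLinearMap.inr ℝ X _) :=
      ((hGd_diff _ hp0 _).hasFDerivAt.comp (u p) (hasFDerivAt_prodMk_right _ _)).fderiv
    rw [hp.fderiv, hpartial]
    ext1 v
    simp only [add_apply, ContinuousLinearMap.comp_apply,
      ContinuousLinearMap.prod_apply, ContinuousLinearMap.inr_apply, ← map_add]
    simp
  have hKbdd : ∀ᶠ p : ℝ × V in l, ‖fderiv ℝ (K p.1) p.2‖ ≤ C * max 1 (‖S₀‖ + 1) := by
    filter_upwards [hK, hC', hDgX.norm.eventually_le_const (u := 1) (by simp),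
      hS.norm.eventually_le_const (lt_add_one ‖S₀‖)] with p hp hpC hpX hpS
    rw [hp.fderiv]
    refine (ContinuousLinearMap.opNorm_comp_le _ _).trans ?_
    rw [ContinuousLinearMap.opNorm_prod, Prod.norm_def]
    exact mul_le_mul hpC.1 (max_le_max hpX hpS) (by positivity)
      ((norm_nonneg _).trans hpC.1)
  exact exists_norm_sub_le_of_tendsto_fderiv A hinj
    (hH.mono fun _ hp => hp.differentiableAt) hHlim
    (hK.mono fun _ hp => hp.differentiableAt) hKbdd

/-- Lipschitz estimate for the `X`-component of the transported disk, under
the hypotheses of the extended transport lemma.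
`ℝ^d` is represented as `(Fin k → ℝ) × (Fin n → ℝ)` with `k = d - n`; block coordinates
`(w̄, v̄) ∈ ℝ^{d-n} × ℝ^n` are the two product components; `X` is a Banach space and
`P ⊂ X` is open and bounded. -/
theorem disk_transport_extended_X_lipschitz
    (n k : ℕ)
    (X : Type*) [NormedAddCommGroup X] [NormedSpace ℝ X] [CompleteSpace X]
    (V W : Submodule ℝ ((Fin k → ℝ) × (Fin n → ℝ)))
    (hVW : IsCompl V W)
    (hdimV : Module.finrank ℝ V = n)
    (hdimW : Module.finrank ℝ W = k)
    (r₁ r₂ : ℝ) (hr₁ : 0 < r₁) (hr₂ : 0 < r₂)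
    (P : Set X) (hPopen : IsOpen P) (hPbdd : Bornology.IsBounded P) (hPne : P.Nonempty)
    (g : V → W)
    -- `g` is a `C¹` disk with values in `B₂`
    (hg : ContDiffOn ℝ 1 g (ball 0 r₁))
    (hgmap : ∀ v ∈ ball (0 : V) r₁, g v ∈ ball (0 : W) r₂)
    -- `gε = (gεX, gεW) : B₁ → P × B₂` are `C¹` disks
    (gεX : ℝ → V → X) (gεW : ℝ → V → W)
    (hgε : ∀ ε : ℝ, 0 < ε →
      ContDiffOn ℝ 1 (fun v : V => (gεX ε v, gεW ε v)) (ball 0 r₁) ∧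
      ∀ v ∈ ball (0 : V) r₁, gεX ε v ∈ P ∧ gεW ε v ∈ ball (0 : W) r₂)
    -- `sup_{v ∈ B₁} ‖DgεX(v)‖ ≤ E(ε)` with `E(ε) → 0` as `ε → 0`
    (Ebnd : ℝ → ℝ)
    (hEtend : ∀ δ : ℝ, 0 < δ → ∃ ε₁ : ℝ, 0 < ε₁ ∧ ∀ ε : ℝ, 0 < ε → ε ≤ ε₁ → Ebnd ε ≤ δ)
    (hEbnd : ∀ ε : ℝ, 0 < ε → ∀ v ∈ ball (0 : V) r₁, ‖fderiv ℝ (gεX ε) v‖ ≤ Ebnd ε)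
    -- `C¹` convergence of `gεW` to `g` on `B₁` as `ε → 0`
    (hgconv : ∀ δ : ℝ, 0 < δ → ∃ ε₁ : ℝ, 0 < ε₁ ∧ ∀ ε : ℝ, 0 < ε → ε ≤ ε₁ →
      ∀ v ∈ ball (0 : V) r₁,
        ‖gεW ε v - g v‖ + ‖fderiv ℝ (gεW ε) v - fderiv ℝ g v‖ ≤ δ)
    -- `Gε = (GεX, Gεd) : X × ℝ^d → X × ℝ^d` are `C¹` mappings, `G : ℝ^d → ℝ^d` is `C¹`
    (GεX : ℝ → X × ((Fin k → ℝ) × (Fin n → ℝ)) → X)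
    (Gεd : ℝ → X × ((Fin k → ℝ) × (Fin n → ℝ)) → (Fin k → ℝ) × (Fin n → ℝ))
    (hGε : ∀ ε : ℝ, 0 < ε → ContDiff ℝ 1 (fun p => (GεX ε p, Gεd ε p)))
    (G : (Fin k → ℝ) × (Fin n → ℝ) → (Fin k → ℝ) × (Fin n → ℝ))
    (hG : ContDiff ℝ 1 G)
    -- `C¹` convergence of `Gεd(η, ·)` to `G` uniformly for `η ∈ P`, `u ∈ B₁ + B₂`
    (hGconv : ∀ δ : ℝ, 0 < δ → ∃ ε₁ : ℝ, 0 < ε₁ ∧ ∀ ε : ℝ, 0 < ε → ε ≤ ε₁ → ∀ η ∈ P,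
      ∀ u : (Fin k → ℝ) × (Fin n → ℝ),
        (∃ v ∈ ball (0 : V) r₁, ∃ w ∈ ball (0 : W) r₂, u = ↑v + ↑w) →
        ‖Gεd ε (η, u) - G u‖ +
          ‖fderiv ℝ (fun u' => Gεd ε (η, u')) u - fderiv ℝ G u‖ ≤ δ)
    -- `‖DGε‖` bounded uniformly in `ε` on bounded sets
    (hDGbdd : ∀ S : Set (X × ((Fin k → ℝ) × (Fin n → ℝ))), Bornology.IsBounded S →
      ∃ C : ℝ, ∀ ε : ℝ, 0 < ε → ∀ p ∈ S,
        ‖fderiv ℝ (fun q => (GεX ε q, Gεd ε q)) p‖ ≤ C)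
    -- `z₀ = v₀ + g(v₀) ∈ graph(g)` with `DG(z₀)` invertible
    (v₀ : V) (hv₀ : v₀ ∈ ball (0 : V) r₁)
    (z₀ : (Fin k → ℝ) × (Fin n → ℝ)) (hz₀ : z₀ = ↑v₀ + ↑(g v₀))
    (hDG : Function.Bijective (fderiv ℝ G z₀))
    -- an invertible matrix mapping `{0} × ℝ^n` onto `T_{G(z₀)}(G ∘ (Id + g)) = DG(z₀)·T_{z₀}g`
    (M : ((Fin k → ℝ) × (Fin n → ℝ)) ≃L[ℝ] ((Fin k → ℝ) × (Fin n → ℝ)))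
    (hM : M '' {p | p.1 = 0} =
      {p : (Fin k → ℝ) × (Fin n → ℝ) |
        ∃ v : V, p = fderiv ℝ G z₀ (↑v + ↑(fderiv ℝ g v₀ v))}) :
    ∃ ε₀ : ℝ, 0 < ε₀ ∧ ∃ δ : ℝ, 0 < δ ∧ ∃ L₂ : ℝ, 0 ≤ L₂ ∧
      ∀ ε : ℝ, 0 < ε → ε ≤ ε₀ → ∀ v₁ v₂ : V,
        ‖v₁‖ ≤ δ → ‖v₂‖ ≤ δ →
        v₁ + v₀ ∈ ball (0 : V) r₁ → v₂ + v₀ ∈ ball (0 : V) r₁ →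
        ∀ wb₁ vb₁ wb₂ vb₂,
          Gεd ε (gεX ε (v₁ + v₀), ↑(v₁ + v₀) + ↑(gεW ε (v₁ + v₀))) = M (wb₁, vb₁) →
          Gεd ε (gεX ε (v₂ + v₀), ↑(v₂ + v₀) + ↑(gεW ε (v₂ + v₀))) = M (wb₂, vb₂) →
          ‖GεX ε (gεX ε (v₂ + v₀), ↑(v₂ + v₀) + ↑(gεW ε (v₂ + v₀))) -
              GεX ε (gεX ε (v₁ + v₀), ↑(v₁ + v₀) + ↑(gεW ε (v₁ + v₀)))‖ ≤
            L₂ * ‖((0, vb₂ - vb₁) : (Fin k → ℝ) × (Fin n → ℝ))‖ := by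
  set A : (Fin k → ℝ) × (Fin n → ℝ) →L[ℝ] (Fin n → ℝ) :=
    (ContinuousLinearMap.snd ℝ _ _).comp (M.symm : _ →L[ℝ] (Fin k → ℝ) × (Fin n → ℝ)) with hA_def
  have hinj : Function.Injective (A.comp ((fderiv ℝ G z₀).comp
      (V.subtypeL + W.subtypeL.comp (fderiv ℝ g v₀)))) := by
    rw [injective_iff_map_eq_zero]
    intro v hv
    obtain ⟨q, hq1, hq⟩ : fderiv ℝ G z₀ (↑v + ↑(fderiv ℝ g v₀ v)) ∈ M '' {p | p.1 = 0} := by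
      rw [hM]
      exact ⟨v, rfl⟩
    have hq2 : q.2 = 0 := by
      have hAv : (M.symm (fderiv ℝ G z₀ (↑v + ↑(fderiv ℝ g v₀ v)))).2 = 0 := hv
      rwa [← hq, M.symm_apply_apply] at hAv
    have hq0 : q = 0 := Prod.ext hq1 hq2
    rw [hq0, map_zero] at hq
    have hSv : (v : (Fin k → ℝ) × (Fin n → ℝ)) + ↑(fderiv ℝ g v₀ v) = 0 :=
      hDG.1 (hq.symm.trans (map_zero _).symm)
    have hvW : (v : (Fin k → ℝ) × (Fin n → ℝ)) ∈ W := by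
      rw [eq_neg_of_add_eq_zero_left hSv]
      exact W.neg_mem (SetLike.coe_mem _)
    exact Subtype.ext (Submodule.disjoint_def.1 hVW.disjoint _ v.2 hvW)
  obtain ⟨ε₀, hε₀, δ, hδ, L₂, hL₂, hmain⟩ := exists_norm_sub_le_of_disk_transport
    V.subtypeL W.subtypeL hPbdd hg hgε hEtend hEbnd hgconv hGε hG hGconv hDGbdd hv₀ hz₀ A hinj
  refine ⟨ε₀, hε₀, δ, hδ, L₂, hL₂, fun ε hε hε' v₁ v₂ hv₁ hv₂ _ _ wb₁ vb₁ wb₂ vb₂ h₁ h₂ => ?_⟩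
  have h := hmain ε hε hε' (v₁ + v₀) (by simpa using hv₁) (v₂ + v₀) (by simpa using hv₂)
  have hA : A (Gεd ε (gεX ε (v₂ + v₀), ↑(v₂ + v₀) + ↑(gεW ε (v₂ + v₀))) -
      Gεd ε (gεX ε (v₁ + v₀), ↑(v₁ + v₀) + ↑(gεW ε (v₁ + v₀)))) = vb₂ - vb₁ := by
    rw [h₁, h₂, ← map_sub]
    simp [hA_def]
  simp only [Submodule.subtypeL_apply] at h
  rw [hA] at h
  have hnorm : ‖((0, vb₂ - vb₁) : (Fin k → ℝ) × (Fin n → ℝ))‖ = ‖vb₂ - vb₁‖ := by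
    simp [Prod.norm_def]
  rw [hnorm]
  exact h
end
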